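/- arXiv:2212.04900 — 5 statements merged into one kernel-verified Lean document; each statement's English description precedes it below -/
import Mathlib

section
/- Let E be a uniformly convex real Banach space and let A ⊆ E be a nonempty bounded subset. Then there exists a unique point z ∈ E such that sup_{a∈A} ‖z − a‖ = inf_{x∈E} sup_{a∈A} ‖x − a‖ (i.e. A has a unique Chebyshev centre). -/
section ChebyshevCentre

variable {E : Type*} [NormedAddCommGroup E]

lemma Bornology.IsBounded.bddAbove_range_norm_sub {A : Set E} (hA : Bornology.IsBounded A)
    (x : E) : BddAbove (Set.range fun a : A => ‖x - (a : E)‖) := by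
  obtain ⟨C, hC⟩ := hA.exists_norm_le
  refine ⟨‖x‖ + C, ?_⟩
  rintro _ ⟨a, rfl⟩
  exact (norm_sub_le _ _).trans (by gcongr; exact hC a a.2)

lemma bddBelow_range_iSup_norm_sub (A : Set E) :
    BddBelow (Set.range fun x : E => ⨆ a : A, ‖x - (a : E)‖) :=
  ⟨0, by rintro _ ⟨x, rfl⟩; exact Real.iSup_nonneg fun _ => norm_nonneg _⟩

lemma lipschitzWith_iSup_norm_sub {A : Set E} (hA : A.Nonempty) (hAbdd : Bornology.IsBounded A) :
    LipschitzWith 1 fun x : E => ⨆ a : A, ‖x - (a : E)‖ := by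
  have : Nonempty A := hA.to_subtype
  refine LipschitzWith.of_le_add fun x y => ciSup_le fun a => ?_
  have h₁ := le_ciSup (hAbdd.bddAbove_range_norm_sub y) a
  have h₂ := norm_sub_le_norm_sub_add_norm_sub x y (a : E)
  rw [dist_eq_norm]
  linarith

/-- In a uniformly convex space, points which almost realise the Chebyshev radius of a bounded
set are close to each other. -/
lemma exists_forall_iSup_norm_sub_le_imp_norm_sub_lt [NormedSpace ℝ E] [UniformConvexSpace E]
    {A : Set E} (hA : A.Nonempty) (hAbdd : Bornology.IsBounded A) {ε : ℝ} (hε : 0 < ε) :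
    ∃ η > 0, ∀ x y : E, (⨆ a : A, ‖x - (a : E)‖) ≤ (⨅ w : E, ⨆ a : A, ‖w - (a : E)‖) + η →
      (⨆ a : A, ‖y - (a : E)‖) ≤ (⨅ w : E, ⨆ a : A, ‖w - (a : E)‖) + η → ‖x - y‖ < ε := by
  have : Nonempty A := hA.to_subtype
  set ρ := ⨅ w : E, ⨆ a : A, ‖w - (a : E)‖
  have hρ : 0 ≤ ρ := Real.iInf_nonneg fun _ => Real.iSup_nonneg fun _ => norm_nonneg _
  obtain ⟨δ, hδ, h⟩ := exists_forall_closed_ball_dist_add_le_two_sub E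
    (show 0 < ε / (ρ + 1) by positivity)
  set η := min 1 (δ * ε / 8)
  have hη : 0 < η := by positivity
  have hη₁ : η ≤ 1 := min_le_left _ _
  have hη₂ : η ≤ δ * ε / 8 := min_le_right _ _
  refine ⟨η, hη, fun x y hx hy => ?_⟩
  by_contra! hxy
  set s := ρ + η with hs
  have hs₀ : 0 < s := by positivity
  have hxa (a : A) : ‖x - a‖ ≤ s := (le_ciSup (hAbdd.bddAbove_range_norm_sub x) a).trans hx
  have hya (a : A) : ‖y - a‖ ≤ s := (le_ciSup (hAbdd.bddAbove_range_norm_sub y) a).trans hy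
  have hεs : ε ≤ 2 * s := by
    obtain ⟨a⟩ := this
    have := norm_sub_le (x - a) (y - a)
    rw [sub_sub_sub_cancel_right] at this
    linarith [hxa a, hya a]
  have hscale (v : E) : ‖s⁻¹ • v‖ = ‖v‖ / s := by
    rw [norm_smul_of_nonneg (by positivity), inv_mul_eq_div]
  have hmid : ρ ≤ (1 - δ / 2) * s := by
    refine (ciInf_le (bddBelow_range_iSup_norm_sub A) ((2 : ℝ)⁻¹ • (x + y))).trans
      (ciSup_le fun a => ?_)
    have key := @h (s⁻¹ • (x - a)) (by rw [hscale, div_le_one hs₀]; exact hxa a)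
      (s⁻¹ • (y - a)) (by rw [hscale, div_le_one hs₀]; exact hya a) (by
        rw [← smul_sub, sub_sub_sub_cancel_right, hscale]
        gcongr
        linarith)
    rw [← smul_add, hscale, div_le_iff₀ hs₀] at key
    have heq : (2 : ℝ)⁻¹ • (x + y) - (a : E) = (2 : ℝ)⁻¹ • ((x - a) + (y - a)) := by module
    rw [heq, norm_smul_of_nonneg (by norm_num)]
    linarith
  nlinarith [mul_le_mul_of_nonneg_left hεs hδ.le, mul_pos hδ hε]

end ChebyshevCentre

/-- **Existence and uniqueness of the Chebyshev centre** in a uniformly convex real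
Banach space: for every nonempty bounded subset `A` there is a unique point `z`
realising the Chebyshev radius `⨅ x, ⨆ a ∈ A, ‖x - a‖`. -/
theorem exists_unique_chebyshev_centre
    {E : Type*} [NormedAddCommGroup E] [NormedSpace ℝ E]
    [UniformConvexSpace E] [CompleteSpace E]
    (A : Set E) (hA : A.Nonempty) (hAbdd : Bornology.IsBounded A) :
    ∃! z : E, (⨆ a : A, ‖z - (a : E)‖) = ⨅ x : E, ⨆ a : A, ‖x - (a : E)‖ := by
  have hclose {ε : ℝ} := exists_forall_iSup_norm_sub_le_imp_norm_sub_lt (ε := ε) hA hAbdd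
  set r : E → ℝ := fun x => ⨆ a : A, ‖x - (a : E)‖
  set ρ : ℝ := ⨅ x, r x
  have hρ (x : E) : ρ ≤ r x := ciInf_le (bddBelow_range_iSup_norm_sub A) x
  choose u hu using fun n : ℕ => exists_lt_of_ciInf_lt
    (show ⨅ x, r x < ρ + 1 / ((n : ℝ) + 1) from lt_add_of_pos_right _ (by positivity))
  have hcauchy : CauchySeq u := by
    refine Metric.cauchySeq_iff.2 fun ε hε => ?_
    obtain ⟨η, hη, h⟩ := hclose hε
    obtain ⟨N, hN⟩ := exists_nat_one_div_lt hη
    have hle (n : ℕ) (hn : n ≥ N) : r (u n) ≤ ρ + η := by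
      linarith [hu n, Nat.one_div_le_one_div (α := ℝ) hn]
    exact ⟨N, fun m hm n hn => by
      rw [dist_eq_norm]
      exact h _ _ (hle m hm) (hle n hn)⟩
  obtain ⟨z, hz⟩ := cauchySeq_tendsto_of_complete hcauchy
  have hrz : r z ≤ ρ := by
    refine le_of_tendsto_of_tendsto'
      (((lipschitzWith_iSup_norm_sub hA hAbdd).continuous.tendsto z).comp hz)
      (?_ : Filter.Tendsto (fun n : ℕ => ρ + 1 / ((n : ℝ) + 1)) Filter.atTop (nhds ρ))
      fun n => (hu n).le
    simpa using tendsto_one_div_add_atTop_nhds_zero_nat.const_add ρ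
  refine ⟨z, hrz.antisymm (hρ z), fun y hy => ?_⟩
  by_contra hne
  obtain ⟨η, hη, h⟩ := hclose (norm_pos_iff.2 (sub_ne_zero.2 hne))
  exact lt_irrefl _ (h y z (hy.le.trans (by linarith)) (by linarith))
end

section
/- Let E be a uniformly convex real Banach space, let A ⊆ E be a nonempty bounded subset with Chebyshev centre Z(A) and Chebyshev radius ρ(A), and let ε > 0. Then the annulus D = {a ∈ A : ‖a − Z(A)‖ ≥ ρ(A) − ε} is nonempty, and the Chebyshev centre of D equals Z(A). -/
/-- If no ball of radius less than `ρ` contains `A`, and `A` lies in the ball of radius `ρ`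
centred at `z`, then no ball of radius less than `ρ` contains the part of `A` at distance
at least `ρ - ε` from `z`. -/
theorem le_radius_of_annulus_subset_closedBall
    {E : Type*} [SeminormedAddCommGroup E] [NormedSpace ℝ E] {A : Set E} {z : E} {ρ ε : ℝ}
    (hε : 0 < ε) (hz : ∀ a ∈ A, ‖z - a‖ ≤ ρ)
    (hρ : ∀ (x : E) (s : ℝ), (∀ a ∈ A, ‖x - a‖ ≤ s) → ρ ≤ s)
    {w : E} {s : ℝ} (hw : ∀ a ∈ A, ρ - ε ≤ ‖a - z‖ → ‖w - a‖ ≤ s) : ρ ≤ s := by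
  by_contra! hs
  have hN : 0 < ‖w - z‖ + 1 := by positivity
  obtain ⟨t, ht0, ht1, htε⟩ : ∃ t : ℝ, 0 < t ∧ t ≤ 1 ∧ t * (‖w - z‖ + 1) ≤ ε / 2 :=
    ⟨min 1 (ε / 2 / (‖w - z‖ + 1)), lt_min one_pos (by positivity), min_le_left _ _,
      (le_div_iff₀ hN).1 (min_le_right _ _)⟩
  refine (hρ (z + t • (w - z)) (max (ρ - t * (ρ - s)) (ρ - ε / 2)) fun a ha => ?_).not_gt
    (max_lt (by nlinarith) (by linarith))
  by_cases had : ρ - ε ≤ ‖a - z‖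
  · refine le_max_of_le_left ?_
    calc ‖z + t • (w - z) - a‖ = ‖(1 - t) • (z - a) + t • (w - a)‖ := by
          congr 1; module
      _ ≤ (1 - t) * ‖z - a‖ + t * ‖w - a‖ := by
          refine (norm_add_le _ _).trans_eq ?_
          rw [norm_smul_of_nonneg (by linarith), norm_smul_of_nonneg ht0.le]
      _ ≤ (1 - t) * ρ + t * s := by
          gcongr
          · exact hz a ha
          · exact hw a ha had
      _ = ρ - t * (ρ - s) := by ring
  · refine le_max_of_le_right ?_
    calc ‖z + t • (w - z) - a‖ = ‖(z - a) + t • (w - z)‖ := by congr 1; abel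
      _ ≤ ‖a - z‖ + t * ‖w - z‖ := by
          refine (norm_add_le _ _).trans_eq ?_
          rw [norm_smul_of_nonneg ht0.le, norm_sub_rev]
      _ ≤ ρ - ε / 2 := by linarith

theorem bddAbove_range_norm_sub_of_isBounded
    {E : Type*} [SeminormedAddCommGroup E] {A : Set E} (hA : Bornology.IsBounded A) (x : E) :
    BddAbove (Set.range fun a : A => ‖x - (a : E)‖) := by
  obtain ⟨C, hC⟩ := hA.exists_norm_le
  refine ⟨‖x‖ + C, ?_⟩
  rintro _ ⟨a, rfl⟩
  exact norm_sub_le_of_le le_rfl (hC a a.2)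

/-- **The Chebyshev centre of an annulus.** Let `A` be a nonempty bounded subset of a
uniformly convex real Banach space, with Chebyshev centre `z` and Chebyshev radius
`ρ(A) = ⨅ x, ⨆ a ∈ A, ‖x - a‖`.  For `ε > 0`, the annulus
`D = {a ∈ A | ‖a - z‖ ≥ ρ(A) - ε}` is nonempty and has Chebyshev centre `z`
(i.e. `z` realises the Chebyshev radius of `D`, hence by uniqueness of Chebyshev
centres in uniformly convex spaces, the Chebyshev centre of `D` equals `z`). -/
theorem chebyshev_centre_of_annulus
    {E : Type*} [NormedAddCommGroup E] [NormedSpace ℝ E]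
    [UniformConvexSpace E] [CompleteSpace E]
    (A : Set E) (hA : A.Nonempty) (hAbdd : Bornology.IsBounded A)
    (z : E)
    (hz : (⨆ a : A, ‖z - (a : E)‖) = ⨅ x : E, ⨆ a : A, ‖x - (a : E)‖)
    (ε : ℝ) (hε : 0 < ε) :
    ({a ∈ A | (⨅ x : E, ⨆ a : A, ‖x - (a : E)‖) - ε ≤ ‖a - z‖} : Set E).Nonempty ∧
    (⨆ d : ({a ∈ A | (⨅ x : E, ⨆ a : A, ‖x - (a : E)‖) - ε ≤ ‖a - z‖} : Set E), ‖z - (d : E)‖)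
      = ⨅ x : E,
          ⨆ d : ({a ∈ A | (⨅ x : E, ⨆ a : A, ‖x - (a : E)‖) - ε ≤ ‖a - z‖} : Set E),
            ‖x - (d : E)‖ := by
  have : Nonempty A := hA.to_subtype
  have hinf (x : E) : (⨅ x : E, ⨆ a : A, ‖x - (a : E)‖) ≤ ⨆ a : A, ‖x - (a : E)‖ :=
    ciInf_le ⟨0, by rintro _ ⟨y, rfl⟩; exact Real.iSup_nonneg fun _ => norm_nonneg _⟩ x
  generalize (⨅ x : E, ⨆ a : A, ‖x - (a : E)‖) = ρ at hz hinf ⊢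
  have hzA : ∀ a ∈ A, ‖z - a‖ ≤ ρ := fun a ha =>
    hz ▸ le_ciSup (bddAbove_range_norm_sub_of_isBounded hAbdd z) (⟨a, ha⟩ : A)
  have hρ (x : E) (s : ℝ) (h : ∀ a ∈ A, ‖x - a‖ ≤ s) : ρ ≤ s :=
    (hinf x).trans (ciSup_le fun a => h a a.2)
  set D : Set E := {a ∈ A | ρ - ε ≤ ‖a - z‖}
  have hDA : D ⊆ A := fun _ h => h.1
  have hDne : D.Nonempty := by
    obtain ⟨a, ha⟩ := exists_lt_of_lt_ciSup (show ρ - ε < ⨆ a : A, ‖z - (a : E)‖ by linarith)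
    exact ⟨a, a.2, norm_sub_rev z (a : E) ▸ ha.le⟩
  have : Nonempty D := hDne.to_subtype
  have hle (w : E) : ρ ≤ ⨆ d : D, ‖w - (d : E)‖ :=
    le_radius_of_annulus_subset_closedBall hε hzA hρ fun a ha had =>
      le_ciSup (bddAbove_range_norm_sub_of_isBounded (hAbdd.subset hDA) w) (⟨a, ha, had⟩ : D)
  refine ⟨hDne, le_antisymm ?_ (ciInf_le ⟨ρ, Set.forall_mem_range.2 hle⟩ z)⟩
  exact (ciSup_le fun d : D => hzA d (hDA d.2)).trans (le_ciInf hle)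
end

section
/- Let G be a bornological group, H ≤ G a subgroup which is coarsely dense (there is a bounded C ⊆ G with C·H = G), and let α be a controlled action of G by isometric bijections on a uniformly convex real Banach space E. If there is a point of E fixed by every element of H, then there is a point of E fixed by every element of G. -/
/-- In a uniformly convex space, if `R` is a lower bound for the radii of closed balls containing
the nonempty set `S`, then the centres of closed balls of radius slightly above `R` containing `S`
are close to each other. -/
theorem exists_radius_forall_dist_center_lt
    {E : Type*} [NormedAddCommGroup E] [NormedSpace ℝ E] [UniformConvexSpace E]
    {S : Set E} (hS : S.Nonempty) {R : ℝ} (hR₀ : 0 ≤ R)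
    (hR : ∀ r y, S ⊆ Metric.closedBall y r → R ≤ r) {ε : ℝ} (hε : 0 < ε) :
    ∃ r, R < r ∧ ∀ y z, S ⊆ Metric.closedBall y r → S ⊆ Metric.closedBall z r →
      dist y z < ε := by
  obtain ⟨s₀, hs₀⟩ := hS
  rcases hR₀.eq_or_lt with rfl | hpos
  · refine ⟨ε / 3, by positivity, fun y z hy hz => ?_⟩
    have h₁ := Metric.mem_closedBall'.1 (hy hs₀)
    have h₂ := Metric.mem_closedBall.1 (hz hs₀)
    linarith [dist_triangle y s₀ z]
  · obtain ⟨δ, hδ, hconv⟩ := exists_forall_closed_ball_dist_add_le_two_sub E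
      (show 0 < ε / (R + 1) by positivity)
    obtain ⟨r, hRr, hr⟩ : ∃ r, R < r ∧ r < min (R + 1) (R + R * δ / 2) :=
      exists_between (lt_min (by linarith) (by linarith [mul_pos hpos hδ]))
    obtain ⟨hr₁, hr₂⟩ := lt_min_iff.1 hr
    have hr₀ : 0 < r := hpos.trans hRr
    refine ⟨r, hRr, fun y z hy hz => ?_⟩
    by_contra! hyz
    have hunit : ∀ u, S ⊆ Metric.closedBall u r → ∀ s ∈ S, ‖r⁻¹ • (s - u)‖ ≤ 1 := by
      intro u hu s hs
      rw [norm_smul, norm_inv, Real.norm_of_nonneg hr₀.le, inv_mul_le_iff₀ hr₀, mul_one,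
        ← dist_eq_norm]
      exact hu hs
    have hmid : S ⊆ Metric.closedBall (midpoint ℝ y z) (r * (1 - δ / 2)) := by
      intro s hs
      have hsep : ε / (R + 1) ≤ ‖r⁻¹ • (s - y) - r⁻¹ • (s - z)‖ := by
        rw [← smul_sub, sub_sub_sub_cancel_left, norm_smul, norm_inv,
          Real.norm_of_nonneg hr₀.le, ← dist_eq_norm, dist_comm, inv_mul_eq_div]
        gcongr
      have hsum := hconv (hunit y hy s hs) (hunit z hz s hs) hsep
      have heq : s - midpoint ℝ y z = (r / 2) • (r⁻¹ • (s - y) + r⁻¹ • (s - z)) := by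
        rw [midpoint_eq_smul_add, ← smul_add, smul_smul]
        have : r / 2 * r⁻¹ = 1 / 2 := by field_simp
        rw [this, invOf_eq_inv]
        module
      rw [Metric.mem_closedBall, dist_eq_norm, heq, norm_smul,
        Real.norm_of_nonneg (by positivity)]
      calc r / 2 * ‖r⁻¹ • (s - y) + r⁻¹ • (s - z)‖ ≤ r / 2 * (2 - δ) := by gcongr
        _ = r * (1 - δ / 2) := by ring
    nlinarith [hR _ _ hmid, mul_lt_mul_of_pos_right hRr hδ]

/-- A nonempty bounded subset of a uniformly convex Banach space has a unique Chebyshev centre. -/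
theorem existsUnique_chebyshev_center
    {E : Type*} [NormedAddCommGroup E] [NormedSpace ℝ E] [UniformConvexSpace E]
    [CompleteSpace E] {S : Set E} (hS : S.Nonempty) (hb : Bornology.IsBounded S) :
    ∃ R, ∃! y, S ⊆ Metric.closedBall y R := by
  set radii : Set ℝ := {r | ∃ y, S ⊆ Metric.closedBall y r} with hradii
  obtain ⟨s₀, hs₀⟩ := hS
  have hnonneg : ∀ r ∈ radii, 0 ≤ r := fun r ⟨y, hy⟩ => dist_nonneg.trans (hy hs₀)
  have hne : radii.Nonempty := by
    obtain ⟨r, hr⟩ := hb.subset_closedBall 0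
    exact ⟨r, 0, hr⟩
  set R := sInf radii with hRdef
  have hR₀ : 0 ≤ R := le_csInf hne hnonneg
  have hR : ∀ r y, S ⊆ Metric.closedBall y r → R ≤ r :=
    fun r y h => csInf_le ⟨0, hnonneg⟩ ⟨y, h⟩
  have hclose := fun {ε : ℝ} (hε : 0 < ε) =>
    exists_radius_forall_dist_center_lt ⟨s₀, hs₀⟩ hR₀ hR hε
  have hcenter : ∀ r, R < r → ∃ y, S ⊆ Metric.closedBall y r := by
    intro r hr
    obtain ⟨r', ⟨y, hy⟩, hr'⟩ := exists_lt_of_csInf_lt hne hr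
    exact ⟨y, hy.trans (Metric.closedBall_subset_closedBall hr'.le)⟩
  obtain ⟨ρ, -, hρ, hρlim⟩ := exists_seq_strictAnti_tendsto R
  choose y hy using fun n => hcenter (ρ n) (hρ n)
  have hevent : ∀ r, R < r → ∃ N, ∀ n ≥ N, S ⊆ Metric.closedBall (y n) r := by
    intro r hr
    obtain ⟨N, hN⟩ := Filter.eventually_atTop.1 (hρlim.eventually_lt_const hr)
    exact ⟨N, fun n hn => (hy n).trans (Metric.closedBall_subset_closedBall (hN n hn).le)⟩
  have hcauchy : CauchySeq y := by
    refine Metric.cauchySeq_iff.2 fun ε hε => ?_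
    obtain ⟨r, hr, hdist⟩ := hclose hε
    obtain ⟨N, hN⟩ := hevent r hr
    exact ⟨N, fun m hm n hn => hdist _ _ (hN m hm) (hN n hn)⟩
  obtain ⟨c, hc⟩ := cauchySeq_tendsto_of_complete hcauchy
  refine ⟨R, c, fun s hs => ?_, fun z hz => ?_⟩
  · exact le_of_tendsto_of_tendsto' (tendsto_const_nhds.dist hc) hρlim fun n => hy n hs
  · refine tendsto_nhds_unique (tendsto_iff_dist_tendsto_zero.2 ?_) hc
    refine Metric.tendsto_atTop.2 fun ε hε => ?_
    obtain ⟨r, hr, hdist⟩ := hclose hε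
    obtain ⟨N, hN⟩ := hevent r hr
    refine ⟨N, fun n hn => ?_⟩
    rw [Real.dist_0_eq_abs, abs_of_nonneg dist_nonneg]
    exact hdist _ _ (hN n hn) (hz.trans (Metric.closedBall_subset_closedBall hr.le))


open Pointwise

/-- **Fixed points extend from coarsely dense subgroups** (Proposition
`prop-dense-subgroup` of the paper, Banach-space case).  Let `G` be a bornological
group, `H ≤ G` a coarsely dense subgroup (`C · H = G` for some bounded `C`), and `α` a
controlled action of `G` by isometric bijections on a uniformly convex real Banach
space `E`.  If some point of `E` is fixed by `H`, then some point of `E` is fixed by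
`G`. -/
theorem fixed_point_of_coarsely_dense_subgroup
    {G : Type*} [Group G] [Bornology G]
    (hmul : ∀ A B : Set G, Bornology.IsBounded A → Bornology.IsBounded B →
      Bornology.IsBounded (A * B))
    (hinv : ∀ A : Set G, Bornology.IsBounded A → Bornology.IsBounded A⁻¹)
    {E : Type*} [NormedAddCommGroup E] [NormedSpace ℝ E] [UniformConvexSpace E]
    [CompleteSpace E]
    (H : Subgroup G)
    (hdense : ∃ C : Set G, Bornology.IsBounded C ∧ C * (H : Set G) = Set.univ)
    (α : G →* (E ≃ᵢ E))
    (hcontrolled : ∀ A : Set G, Bornology.IsBounded A → ∀ x : E,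
      Bornology.IsBounded ((fun a => α a x) '' A))
    (hfix : ∃ x : E, ∀ h ∈ H, α h x = x) :
    ∃ x : E, ∀ g : G, α g x = x := by
  obtain ⟨C, hC, hCH⟩ := hdense
  obtain ⟨x, hx⟩ := hfix
  have horbit : Set.range (fun g => α g x) ⊆ (fun a => α a x) '' C := by
    rintro _ ⟨g, rfl⟩
    obtain ⟨c, hc, h, hh, rfl⟩ := Set.mem_mul.1 (hCH ▸ Set.mem_univ g)
    exact ⟨c, hc, by simp [hx h hh]⟩
  obtain ⟨R, y, hy, huniq⟩ := existsUnique_chebyshev_center (Set.range_nonempty _)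
    ((hcontrolled C hC x).subset horbit)
  refine ⟨y, fun g => huniq _ ?_⟩
  rintro _ ⟨k, rfl⟩
  have hk : α k x = α g (α (g⁻¹ * k) x) := by
    rw [← IsometryEquiv.mul_apply, ← map_mul, mul_inv_cancel_left]
  rw [Metric.mem_closedBall]
  simp only [hk, IsometryEquiv.dist_eq]
  exact hy ⟨g⁻¹ * k, rfl⟩
end

section
/- Let G be a bornological group with bounded geometry and let α be a controlled action of G by affine isractions... correction: by affine isometries on a real Hilbert space H. Then there exists v ∈ H such that for every bounded D ⊆ G and every w in the closed affine span of the orbit {α(g)v : g ∈ G}, the set {α(d)w : d ∈ D} is relatively compact. In particular, there is a nonempty closed invariant affine subspace H′ of H on which the restriction of α is well controlled. -/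
open Pointwise

open Filter Topology Bornology

/-- If `u` converges along `bind F m` and along each `m a`, then the limits along the `m a`
converge along `F` to the limit along `bind F m`. -/
theorem tendsto_of_tendsto_bind {ι κ X : Type*} [TopologicalSpace X] [RegularSpace X]
    {F : Filter ι} {m : ι → Filter κ} [∀ a, NeBot (m a)] {u : κ → X} {φ : ι → X} {L : X}
    (hL : Tendsto u (bind F m) (𝓝 L)) (hφ : ∀ a, Tendsto u (m a) (𝓝 (φ a))) :
    Tendsto φ F (𝓝 L) := by
  refine (closed_nhds_basis L).tendsto_right_iff.2 fun K hK => ?_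
  have h : ∀ᶠ a in F, ∀ᶠ b in m a, u b ∈ K := eventually_bind.1 (hL hK.1)
  filter_upwards [h] with a ha
  exact hK.2.mem_of_tendsto (hφ a) ha

/-- A function that is bounded on a member of an ultrafilter converges along it in a proper
space. -/
theorem Ultrafilter.exists_tendsto_of_isBounded {ι X : Type*} [PseudoMetricSpace X] [ProperSpace X]
    (U : Ultrafilter ι) {u : ι → X} {s : Set ι} (hs : s ∈ U) (hb : IsBounded (u '' s)) :
    ∃ x, Tendsto u U (𝓝 x) := by
  obtain ⟨x, -, hx⟩ := hb.isCompact_closure.ultrafilter_le_nhds (U.map u)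
    (le_principal_iff.2 (mem_of_superset (image_mem_map hs) subset_closure))
  exact ⟨x, hx⟩

/-- Along `F`, the family `u` has asymptotic center `y` and asymptotic variance `r`. In a Hilbert
space, `y` is the weak limit of `u`. -/
def HasLimitVariance {ι X : Type*} [PseudoMetricSpace X] (u : ι → X) (F : Filter ι) (y : X)
    (r : ℝ) : Prop :=
  ∀ z, Tendsto (fun i => dist (u i) z ^ 2) F (𝓝 (r + dist y z ^ 2))

namespace HasLimitVariance

variable {ι X : Type*} [PseudoMetricSpace X] {u : ι → X} {F : Filter ι} {y : X} {r : ℝ}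

theorem tendsto_self (h : HasLimitVariance u F y r) :
    Tendsto (fun i => dist (u i) y ^ 2) F (𝓝 r) := by
  simpa using h y

theorem nonneg [NeBot F] (h : HasLimitVariance u F y r) : 0 ≤ r :=
  ge_of_tendsto' h.tendsto_self fun _ => sq_nonneg _

theorem tendsto_of_nonpos [NeBot F] (h : HasLimitVariance u F y r) (hr : r ≤ 0) :
    Tendsto u F (𝓝 y) := by
  obtain rfl : r = 0 := le_antisymm hr h.nonneg
  rw [tendsto_iff_dist_tendsto_zero]
  simpa using h.tendsto_self.sqrt

theorem comp_isometryEquiv (h : HasLimitVariance u F y r) (e : X ≃ᵢ X) :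
    HasLimitVariance (fun i => e (u i)) F (e y) r := fun z => by
  have key : ∀ x, dist (e x) z = dist x (e.symm z) := fun x => by
    rw [← e.dist_eq x, e.apply_symm_apply]
  simpa only [key] using h (e.symm z)

/-- Iterating limits adds a nonnegative amount to the asymptotic variance. -/
theorem tendsto_of_bind {κ : Type*} {m : κ → Filter ι} [∀ a, NeBot (m a)] {K : Filter κ}
    {y' : κ → X} {r' : κ → ℝ} (h : HasLimitVariance u (bind K m) y r)
    (hm : ∀ a, HasLimitVariance u (m a) (y' a) (r' a)) (z : X) :
    Tendsto (fun a => r' a + dist (y' a) z ^ 2) K (𝓝 (r + dist y z ^ 2)) :=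
  tendsto_of_tendsto_bind (h z) fun a => hm a z

end HasLimitVariance

section Hilbert

variable {H : Type*} [NormedAddCommGroup H] [InnerProductSpace ℝ H] [CompleteSpace H]

theorem Ultrafilter.exists_hasLimitVariance {ι : Type*} (U : Ultrafilter ι)
    {u : ι → H} {s : Set ι} (hs : s ∈ U) (hb : IsBounded (u '' s)) :
    ∃ y r, HasLimitVariance u U y r := by
  obtain ⟨M, hM⟩ := isBounded_iff_forall_norm_le.1 hb
  obtain ⟨f, -, hf⟩ := (WeakDual.isCompact_closedBall (𝕜 := ℝ) (0 : StrongDual ℝ H)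
    M).ultrafilter_le_nhds
      (U.map fun i => StrongDual.toWeakDual (InnerProductSpace.toDual ℝ H (u i)))
      (le_principal_iff.2 (mem_of_superset (image_mem_map hs) (by
        rintro _ ⟨i, hi, rfl⟩
        simpa using hM _ (Set.mem_image_of_mem u hi))))
  obtain ⟨y, rfl⟩ : ∃ y, StrongDual.toWeakDual (InnerProductSpace.toDual ℝ H y) = f :=
    ⟨(InnerProductSpace.toDual ℝ H).symm (WeakDual.toStrongDual f), by simp⟩
  have hin : ∀ z, Tendsto (fun i => inner ℝ (u i) z) U (𝓝 (inner ℝ y z)) := fun z =>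
    ((WeakDual.eval_continuous (𝕜 := ℝ) z).tendsto _).comp hf
  obtain ⟨L, hL⟩ := U.exists_tendsto_of_isBounded (u := fun i => ‖u i‖) hs
    (isBounded_iff_forall_norm_le.2 ⟨M, by
      rintro _ ⟨i, hi, rfl⟩
      simpa using hM _ (Set.mem_image_of_mem u hi)⟩)
  refine ⟨y, L ^ 2 - ‖y‖ ^ 2, fun z => ?_⟩
  simp only [dist_eq_norm, norm_sub_sq_real]
  convert ((hL.pow 2).sub ((hin z).const_mul 2)).add_const (‖z‖ ^ 2) using 2
  ring

/-- The asymptotic variance of a bounded family attains its maximum over the ultrafilters. -/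
theorem exists_ultrafilter_maximal_variance {ι : Type*} {u : ι → H} {s : Set ι} (hs : s.Nonempty)
    (hb : IsBounded (u '' s)) :
    ∃ (U : Ultrafilter ι) (y : H) (r : ℝ), s ∈ U ∧ HasLimitVariance u U y r ∧
      ∀ (V : Ultrafilter ι) (y' : H) (r' : ℝ), s ∈ V → HasLimitVariance u V y' r' → r' ≤ r := by
  set S : Set ℝ := {r | ∃ U : Ultrafilter ι, s ∈ U ∧ ∃ y, HasLimitVariance u U y r}
  obtain ⟨M, hM⟩ := isBounded_iff_forall_norm_le.1 hb
  have hne : S.Nonempty := by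
    obtain ⟨i, hi⟩ := hs
    have hmem : s ∈ (pure i : Ultrafilter ι) := hi
    obtain ⟨y, r, h⟩ := (pure i : Ultrafilter ι).exists_hasLimitVariance hmem hb
    exact ⟨r, pure i, hmem, y, h⟩
  have hbdd : BddAbove S := by
    refine ⟨M ^ 2, ?_⟩
    rintro r ⟨U, hU, y, h⟩
    have : r + dist y 0 ^ 2 ≤ M ^ 2 := by
      refine le_of_tendsto (h 0) ?_
      filter_upwards [hU] with i hi
      rw [dist_zero_right]
      exact pow_le_pow_left₀ (norm_nonneg _) (hM _ (Set.mem_image_of_mem u hi)) 2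
    nlinarith [sq_nonneg (dist y 0)]
  obtain ⟨ρ, -, hρ, hρS⟩ := exists_seq_tendsto_sSup hne hbdd
  choose V hV y hy using hρS
  have hmem : s ∈ (hyperfilter ℕ).bind V :=
    eventually_bind.2 (Eventually.of_forall hV)
  obtain ⟨y₀, r₀, h⟩ := ((hyperfilter ℕ).bind V).exists_hasLimitVariance hmem hb
  refine ⟨(hyperfilter ℕ).bind V, y₀, r₀, hmem, h, fun W y' r' hW h' => ?_⟩
  have hle : r' ≤ sSup S := le_csSup hbdd ⟨W, hW, y', h'⟩
  have hlim := h.tendsto_of_bind hy y₀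
  have hsup := hρ.mono_left Nat.hyperfilter_le_atTop
  have := le_of_tendsto_of_tendsto' hsup hlim fun n => le_add_of_nonneg_right (sq_nonneg _)
  simp only [dist_self] at this
  linarith

end Hilbert

section Action

variable {G H : Type*} [Group G] [Bornology G] [NormedAddCommGroup H] [InnerProductSpace ℝ H]

/-- The affine subspace of points whose orbit map converges along every ultrafilter containing a
bounded set. -/
def wellControlledSubspace (α : G →* (H ≃ᵃⁱ[ℝ] H)) : AffineSubspace ℝ H where
  carrier := {w | ∀ (U : Ultrafilter G) (A : Set G), IsBounded A → A ∈ U →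
    ∃ y, Tendsto (fun g => α g w) U (𝓝 y)}
  smul_vsub_vadd_mem' c p₁ p₂ p₃ h₁ h₂ h₃ U A hA hU := by
    obtain ⟨y₁, hy₁⟩ := h₁ U A hA hU
    obtain ⟨y₂, hy₂⟩ := h₂ U A hA hU
    obtain ⟨y₃, hy₃⟩ := h₃ U A hA hU
    refine ⟨c • (y₁ -ᵥ y₂) +ᵥ y₃, (((hy₁.vsub hy₂).const_smul c).vadd hy₃).congr fun g => ?_⟩
    rw [AffineIsometryEquiv.map_vadd, map_smul, AffineIsometryEquiv.map_vsub]
    rfl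

variable {α : G →* (H ≃ᵃⁱ[ℝ] H)}

theorem apply_mem_wellControlledSubspace
    (hmul : ∀ A B : Set G, IsBounded A → IsBounded B → IsBounded (A * B)) (h : G) {w : H}
    (hw : w ∈ wellControlledSubspace α) : α h w ∈ wellControlledSubspace α := by
  intro U A hA hU
  obtain ⟨y, hy⟩ := hw (U.map (· * h)) (A * {h}) (hmul _ _ hA isBounded_singleton)
    (Ultrafilter.mem_map.2 (mem_of_superset hU fun g hg =>
      Set.mul_mem_mul hg (Set.mem_singleton h)))
  exact ⟨y, (tendsto_map'_iff.1 hy).congr fun g => by simp⟩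

/-- With bounded geometry, the maximum of the asymptotic variance over a fixed bounded set bounds
the asymptotic variance along every ultrafilter containing a bounded set. -/
theorem variance_le_of_bounded_geometry {C : Set G}
    (hC : ∀ A : Set G, IsBounded A → ∃ t : Finset G, A ⊆ ⋃ g ∈ t, g • C) {x : H} {r : ℝ}
    (hr : ∀ (V : Ultrafilter G) (y' : H) (r' : ℝ), C ∈ V →
      HasLimitVariance (fun g => α g x) V y' r' → r' ≤ r)
    {V : Ultrafilter G} {A : Set G} (hA : IsBounded A) (hV : A ∈ V) {y' : H} {r' : ℝ}
    (h : HasLimitVariance (fun g => α g x) V y' r') : r' ≤ r := by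
  obtain ⟨t, ht⟩ := hC A hA
  obtain ⟨k, -, hk⟩ := (Ultrafilter.finite_biUnion_mem_iff t.finite_toSet).1
    (mem_of_superset hV ht)
  refine hr (V.map (k⁻¹ * ·)) (α k⁻¹ y') r' ?_ fun z => ?_
  · refine Ultrafilter.mem_map.2 (mem_of_superset hk fun g hg => ?_)
    simpa using Set.mem_smul_set_iff_inv_smul_mem.1 hg
  · refine tendsto_map'_iff.2 ((h.comp_isometryEquiv (α k⁻¹).toIsometryEquiv z).congr fun g => ?_)
    simp

variable [CompleteSpace H]

theorem isClosed_wellControlledSubspace : IsClosed (wellControlledSubspace α : Set H) := by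
  refine isClosed_of_closure_subset fun w hw U A hA hU => ?_
  refine CompleteSpace.complete (f := (U.map fun g => α g w : Filter H)) ?_
  refine Metric.cauchy_iff.2 ⟨inferInstance, fun ε hε => ?_⟩
  obtain ⟨w', hw', hd⟩ := Metric.mem_closure_iff.1 hw (ε / 4) (by positivity)
  obtain ⟨y, hy⟩ := hw' U A hA hU
  refine ⟨Metric.ball y (ε / 2), ?_, fun a ha b hb => ?_⟩
  · refine Ultrafilter.mem_map.2 ?_
    filter_upwards [hy (Metric.ball_mem_nhds y (show 0 < ε / 4 by positivity))] with g hg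
    have h₁ : dist (α g w') y < ε / 4 := hg
    have h₂ := dist_triangle (α g w) (α g w') y
    rw [(α g).dist_map] at h₂
    exact Metric.mem_ball.2 (by linarith)
  · linarith [dist_triangle_right a b y, Metric.mem_ball.1 ha, Metric.mem_ball.1 hb]

theorem isCompact_closure_of_mem_wellControlledSubspace {w : H}
    (hw : w ∈ wellControlledSubspace α) {D : Set G} (hD : IsBounded D) :
    IsCompact (closure ((fun d => α d w) '' D)) := by
  refine TotallyBounded.isCompact_of_isClosed (TotallyBounded.closure ?_) isClosed_closure
  refine totallyBounded_iff_ultrafilter.2 fun V hV => ?_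
  have hmem := le_principal_iff.1 hV
  obtain ⟨y, hy⟩ := hw (Ultrafilter.ofComapInfPrincipal hmem) D hD
    (Ultrafilter.ofComapInfPrincipal_mem hmem)
  rw [← Ultrafilter.ofComapInfPrincipal_eq_of_map hmem]
  exact hy.cauchy_map

theorem wellControlledSubspace_nonempty
    (hmul : ∀ A B : Set G, IsBounded A → IsBounded B → IsBounded (A * B))
    (hbg : ∃ C : Set G, IsBounded C ∧ ∀ A : Set G, IsBounded A →
      ∃ t : Finset G, A ⊆ ⋃ g ∈ t, g • C)
    (hcontrolled : ∀ A : Set G, IsBounded A → ∀ x : H, IsBounded ((fun a => α a x) '' A)) :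
    (wellControlledSubspace α : Set H).Nonempty := by
  obtain ⟨C, hCb, hC⟩ := hbg
  have hne : C.Nonempty := by
    obtain ⟨t, ht⟩ := hC {1} isBounded_singleton
    obtain ⟨g, -, c, hc, -⟩ := Set.mem_iUnion₂.1 (ht rfl)
    exact ⟨c, hc⟩
  obtain ⟨U, y, r, hU, hy, hmax⟩ :=
    exists_ultrafilter_maximal_variance hne (hcontrolled C hCb 0)
  refine ⟨y, fun V A hA hV => ?_⟩
  obtain ⟨y₁, r₁, h₁⟩ := V.exists_hasLimitVariance hV (hcontrolled A hA y)
  refine ⟨y₁, h₁.tendsto_of_nonpos ?_⟩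
  have hAC := hmul A C hA hCb
  have hmem : A * C ∈ V.bind fun g => U.map (g * ·) :=
    eventually_bind.2 (mem_of_superset hV fun g hg =>
      mem_of_superset hU fun c hc => Set.mul_mem_mul hg hc)
  obtain ⟨y₂, r₂, h₂⟩ := Ultrafilter.exists_hasLimitVariance _ hmem (hcontrolled _ hAC 0)
  have hle := variance_le_of_bounded_geometry hC hmax hAC hmem h₂
  have hinner : ∀ g, HasLimitVariance (fun k => α k 0) (U.map (g * ·)) (α g y) r := fun g z =>
    tendsto_map'_iff.2 ((hy.comp_isometryEquiv (α g).toIsometryEquiv z).congr fun k => by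
      simp)
  have heq := tendsto_nhds_unique (h₂.tendsto_of_bind hinner y₂) ((h₁ y₂).const_add r)
  rw [dist_self] at heq
  nlinarith [sq_nonneg (dist y₁ y₂)]

end Action

/-- **Well-controlled subactions exist** (Proposition `prop:wellcontrolledSubaction` of
the paper).  Let `G` be a bornological group with bounded geometry and `α` a controlled
affine isometric action of `G` on a real Hilbert space `H`.  Then there is `v ∈ H` such
that for every bounded `D ⊆ G` and every `w` in the closed affine span of the orbit of
`v`, the set `{α d w : d ∈ D}` is relatively compact; in particular there is a nonempty
closed invariant affine subspace of `H` on which the restriction of `α` is well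
controlled. -/
theorem exists_well_controlled_subaction
    {G : Type*} [Group G] [Bornology G]
    (hmul : ∀ A B : Set G, Bornology.IsBounded A → Bornology.IsBounded B →
      Bornology.IsBounded (A * B))
    (hinv : ∀ A : Set G, Bornology.IsBounded A → Bornology.IsBounded A⁻¹)
    (hbg : ∃ C : Set G, Bornology.IsBounded C ∧ ∀ A : Set G, Bornology.IsBounded A →
      ∃ t : Finset G, A ⊆ ⋃ g ∈ t, g • C)
    {H : Type*} [NormedAddCommGroup H] [InnerProductSpace ℝ H] [CompleteSpace H]
    (α : G →* (H ≃ᵃⁱ[ℝ] H))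
    (hcontrolled : ∀ A : Set G, Bornology.IsBounded A → ∀ x : H,
      Bornology.IsBounded ((fun a => α a x) '' A)) :
    (∃ v : H, ∀ D : Set G, Bornology.IsBounded D →
      ∀ w ∈ closure (affineSpan ℝ (Set.range fun g : G => α g v) : Set H),
        IsCompact (closure ((fun d => α d w) '' D))) ∧
    (∃ H' : AffineSubspace ℝ H, (H' : Set H).Nonempty ∧ IsClosed (H' : Set H) ∧
      (∀ g : G, ∀ x ∈ H', α g x ∈ H') ∧
      ∀ D : Set G, Bornology.IsBounded D → ∀ w ∈ H',
        IsCompact (closure ((fun d => α d w) '' D))) := by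
  obtain ⟨v, hv⟩ := wellControlledSubspace_nonempty hmul hbg hcontrolled
  refine ⟨⟨v, fun D hD w hw => ?_⟩, wellControlledSubspace α, ⟨v, hv⟩,
    isClosed_wellControlledSubspace,
    fun g x hx => apply_mem_wellControlledSubspace hmul g hx,
    fun D hD w hw => isCompact_closure_of_mem_wellControlledSubspace hw hD⟩
  refine isCompact_closure_of_mem_wellControlledSubspace (α := α) ?_ hD
  refine closure_minimal ?_ isClosed_wellControlledSubspace hw
  refine affineSpan_le.2 ?_
  rintro _ ⟨g, rfl⟩
  exact apply_mem_wellControlledSubspace hmul g hv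
end

section
/- Let G be a bornological group with bounded geometry whose bornology is generated by a single set. Let p : G → Q be a surjective group homomorphism, and equip Q with the pushforward bornology (the bounded subsets of Q are the subsets of images p(A) of bounded A ⊆ G). Assume the kernel of p is central in G and coarsely contained in the commutator subgroup [G,G], i.e. there is a bounded C ⊆ G with ker(p) ⊆ C·[G,G]. Then G has coarse property (T) if and only if Q has coarse property (T). -/
open Pointwise

section Weak
variable {H : Type*} [NormedAddCommGroup H] [InnerProductSpace ℂ H] [CompleteSpace H]

theorem continuous_inner_toWeakSpace_symm (u : H) :
    Continuous fun y : WeakSpace ℂ H ↦ inner ℂ u ((toWeakSpace ℂ H).symm y) :=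
  WeakBilin.eval_continuous (topDualPairing ℂ H).flip (InnerProductSpace.toDual ℂ H u)

theorem isCompact_weakSpace_closedBall (r : ℝ) :
    IsCompact {y : WeakSpace ℂ H | ‖(toWeakSpace ℂ H).symm y‖ ≤ r} := by
  let T : WeakDual ℂ H → WeakSpace ℂ H := fun f ↦
    toWeakSpace ℂ H ((InnerProductSpace.toDual ℂ H).symm (WeakDual.toStrongDual f))
  have hT : Continuous T := by
    refine WeakBilin.continuous_of_continuous_eval _ fun φ ↦ ?_
    obtain ⟨u, rfl⟩ := (InnerProductSpace.toDual ℂ H).surjective φ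
    have : (fun f : WeakDual ℂ H ↦ (starRingEnd ℂ) (f u)) = fun f ↦
        (topDualPairing ℂ H).flip (T f) (InnerProductSpace.toDual ℂ H u) := by
      ext f
      have h1 : (topDualPairing ℂ H).flip (T f) (InnerProductSpace.toDual ℂ H u) =
        inner ℂ u ((InnerProductSpace.toDual ℂ H).symm (WeakDual.toStrongDual f)) := rfl
      rw [h1, ← inner_conj_symm, InnerProductSpace.toDual_symm_apply]
      rfl
    rw [← this]
    exact Complex.continuous_conj.comp (WeakDual.eval_continuous u)
  have := (WeakDual.isCompact_closedBall (0 : StrongDual ℂ H) r).image hT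
  convert this using 1
  ext y
  constructor
  · intro hy
    refine ⟨StrongDual.toWeakDual (InnerProductSpace.toDual ℂ H ((toWeakSpace ℂ H).symm y)), ?_, ?_⟩
    · simpa using hy
    · simp [T]
  · rintro ⟨f, hf, rfl⟩
    simpa [T] using hf

theorem isClosed_weakSpace_closedBall (x : H) (r : ℝ) :
    IsClosed {y : WeakSpace ℂ H | ‖(toWeakSpace ℂ H).symm y - x‖ ≤ r} := by
  have h := (isCompact_weakSpace_closedBall (H := H) r).isClosed
  have hc : Continuous fun y : WeakSpace ℂ H ↦ y - toWeakSpace ℂ H x := continuous_sub_right _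
  simpa using h.preimage hc

theorem lowerSemicontinuous_norm_sq_weakSpace :
    LowerSemicontinuous fun y : WeakSpace ℂ H ↦ ‖(toWeakSpace ℂ H).symm y‖ ^ 2 := by
  rw [lowerSemicontinuous_iff_isClosed_preimage]
  intro c
  rcases lt_or_ge c 0 with hc | hc
  · convert isClosed_empty
    ext y
    simp only [Set.mem_preimage, Set.mem_Iic, Set.mem_empty_iff_false, iff_false, not_le]
    exact hc.trans_le (sq_nonneg _)
  · convert isClosed_weakSpace_closedBall (0 : H) (Real.sqrt c) using 1
    ext y
    simp only [Set.mem_preimage, Set.mem_Iic, Set.mem_ofPred_eq, sub_zero]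
    exact (Real.le_sqrt (norm_nonneg _) hc).symm

end Weak

/-- If an isometric affine action moves a point by a bounded amount over a set `C`, then near that
point there is one whose orbit is relatively compact along every `A` such that `A * C` is covered by
finitely many translates of `C`. -/
theorem exists_isCompact_orbit {Γ H : Type*} [Group Γ] [NormedAddCommGroup H]
    [InnerProductSpace ℂ H] [CompleteSpace H] (π : Γ →* (H ≃ₗᵢ[ℂ] H)) (b : Γ → H)
    (hb : ∀ g h, b (g * h) = b g + π g (b h)) {C : Set Γ} (hC : C.Nonempty) (x : H) (r : ℝ)
    (hr : ∀ c ∈ C, ‖π c x + b c - x‖ ≤ r) :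
    ∃ y : H, ‖y - x‖ ≤ r ∧ ∀ (A : Set Γ) (t : Finset Γ), A * C ⊆ ⋃ g ∈ t, g • C →
      ∃ K : Set H, IsCompact K ∧ ∀ a ∈ A, π a y + b a ∈ K := by
  let w := toWeakSpace ℂ H
  let α : Γ → H → H := fun g v ↦ π g v + b g
  have hα : ∀ g h v, α (g * h) v = α g (α h v) := fun g h v ↦ by
    simp only [α, map_mul, hb, map_add, LinearIsometryEquiv.coe_mul, Function.comp]; abel
  let F : Γ → WeakSpace ℂ H × ℝ := fun g ↦ (w (α g x), ‖α g x‖ ^ 2)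
  let n : WeakSpace ℂ H × ℝ → ℝ := fun e ↦ e.2 - ‖w.symm e.1‖ ^ 2
  let T : Γ → WeakSpace ℂ H × ℝ → WeakSpace ℂ H × ℝ := fun g e ↦
    (w (α g (w.symm e.1)), e.2 + 2 * RCLike.re (inner ℂ (π g (w.symm e.1)) (b g)) + ‖b g‖ ^ 2)
  have hTF : ∀ g h, T g (F h) = F (g * h) := fun g h ↦ by
    simp only [T, F, LinearEquiv.symm_apply_apply, hα]
    refine Prod.ext rfl ?_
    show _ = ‖π g (α h x) + b g‖ ^ 2
    rw [@norm_add_sq ℂ _ _ _ _ (π g (α h x)), LinearIsometryEquiv.norm_map]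
  have hnT : ∀ g e, n (T g e) = n e := fun g e ↦ by
    simp only [T, n, LinearEquiv.symm_apply_apply]
    show _ - ‖π g (w.symm e.1) + b g‖ ^ 2 = _
    rw [@norm_add_sq ℂ, LinearIsometryEquiv.norm_map]
    ring
  have hTc : ∀ g, Continuous (T g) := fun g ↦ by
    refine Continuous.prodMk ?_ ?_
    · have h1 : Continuous fun y : WeakSpace ℂ H ↦
          WeakSpace.map ((π g : H ≃L[ℂ] H) : H →L[ℂ] H) y + w (b g) :=
        (WeakSpace.map _).continuous.add continuous_const
      exact h1.comp continuous_fst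
    · refine ((continuous_snd.add (continuous_const.mul ?_)).add continuous_const)
      have h2 : ∀ v, RCLike.re (inner ℂ (π g v) (b g)) =
          RCLike.re (inner ℂ ((π g).symm (b g)) v) := fun v ↦ by
        rw [← inner_re_symm (𝕜 := ℂ), ← LinearIsometryEquiv.inner_map_map (π g) ((π g).symm _),
          LinearIsometryEquiv.apply_symm_apply]
      simp only [h2]
      exact Complex.continuous_re.comp ((continuous_inner_toWeakSpace_symm _).comp continuous_fst)
  have husc : UpperSemicontinuous n := by
    have h1 : UpperSemicontinuous fun e : WeakSpace ℂ H × ℝ ↦ -‖w.symm e.1‖ ^ 2 := by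
      intro e c hc
      have := lowerSemicontinuous_norm_sq_weakSpace (H := H) e.1 (-c) (by
        show -c < ‖w.symm e.1‖ ^ 2
        linarith)
      filter_upwards [continuous_fst.continuousAt.eventually this] with e' he'
      change -c < ‖w.symm e'.1‖ ^ 2 at he'
      linarith
    have := (continuous_snd (X := WeakSpace ℂ H) (Y := ℝ)).upperSemicontinuous.add h1
    simpa [n, sub_eq_add_neg] using this
  have hball : ∀ e ∈ closure (F '' C), ‖w.symm e.1 - x‖ ≤ r := by
    refine closure_minimal ?_ ((isClosed_weakSpace_closedBall x r).preimage continuous_fst)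
    rintro _ ⟨c, hc, rfl⟩
    show ‖w.symm (w (α c x)) - x‖ ≤ r
    rw [LinearEquiv.symm_apply_apply]
    exact hr c hc
  set D := closure (F '' C) with hD
  have hDc : IsCompact D := by
    have hbd : ∀ c ∈ C, ‖α c x‖ ≤ ‖x‖ + r := fun c hc ↦ by
      have := norm_le_norm_add_norm_sub x (α c x)
      rw [norm_sub_rev] at this
      linarith [hr c hc]
    refine IsCompact.closure_of_subset ((isCompact_weakSpace_closedBall (H := H) (‖x‖ + r)).prod
      (isCompact_Icc (a := (0 : ℝ)) (b := (‖x‖ + r) ^ 2))) ?_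
    rintro _ ⟨c, hc, rfl⟩
    refine ⟨?_, sq_nonneg _, ?_⟩
    · show ‖w.symm (w (α c x))‖ ≤ _
      rw [LinearEquiv.symm_apply_apply]
      exact hbd c hc
    exact pow_le_pow_left₀ (norm_nonneg _) (hbd c hc) 2
  obtain ⟨e₀, he₀, hmax⟩ := UpperSemicontinuousOn.exists_isMaxOn
    ((hC.image F).closure) hDc (husc.upperSemicontinuousOn D)
  refine ⟨w.symm e₀.1, hball e₀ he₀, fun A t ht ↦ ?_⟩
  set B := ⋃ g ∈ t, T g '' D with hB
  have hBc : IsCompact B := t.isCompact_biUnion fun g _ ↦ hDc.image (hTc g)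
  have hBn : ∀ e ∈ B, n e ≤ n e₀ := by
    intro e he
    simp only [hB, Set.mem_iUnion] at he
    obtain ⟨g, hg, d, hd, rfl⟩ := he
    rw [hnT]
    exact hmax hd
  have hsub : closure (F '' (A * C)) ⊆ B := by
    refine closure_minimal ?_ hBc.isClosed
    rintro _ ⟨a, ha, rfl⟩
    have := ht ha
    simp only [Set.mem_iUnion] at this
    obtain ⟨g, hg, c, hc, rfl⟩ := this
    simp only [hB, Set.mem_iUnion]
    exact ⟨g, hg, F c, subset_closure ⟨c, hc, rfl⟩, by simp [hTF]⟩
  set Y := closure ((fun a ↦ T a e₀) '' A) with hY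
  have hYB : Y ⊆ B := by
    refine (closure_minimal ?_ isClosed_closure).trans hsub
    rintro _ ⟨a, ha, rfl⟩
    refine closure_mono ?_ (image_closure_subset_closure_image (hTc a) ⟨e₀, he₀, rfl⟩)
    rintro _ ⟨_, ⟨c, hc, rfl⟩, rfl⟩
    exact ⟨a * c, Set.mul_mem_mul ha hc, (hTF a c).symm⟩
  have hYn : ∀ e ∈ Y, n e = n e₀ := by
    intro e he
    refine le_antisymm (hBn e (hYB he)) ?_
    have hcl := upperSemicontinuous_iff_isClosed_preimage.1 husc (n e₀)
    refine closure_minimal ?_ hcl he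
    rintro _ ⟨a, ha, rfl⟩
    simp [hnT]
  have hcont : ContinuousOn (fun e : WeakSpace ℂ H × ℝ ↦ w.symm e.1) Y := by
    intro e he
    rw [ContinuousWithinAt, tendsto_iff_norm_sub_tendsto_zero]
    have hq : ∀ e' ∈ Y, ‖w.symm e'.1 - w.symm e.1‖ ^ 2 =
        e'.2 - n e₀ - 2 * RCLike.re (inner ℂ (w.symm e.1) (w.symm e'.1)) + ‖w.symm e.1‖ ^ 2 := by
      intro e' he'
      rw [@norm_sub_sq ℂ, ← hYn e' he', inner_re_symm]
      simp only [n]; ring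
    have hc : Continuous fun e' : WeakSpace ℂ H × ℝ ↦ e'.2 - n e₀ -
        2 * RCLike.re (inner ℂ (w.symm e.1) (w.symm e'.1)) + ‖w.symm e.1‖ ^ 2 :=
      ((continuous_snd.sub continuous_const).sub (continuous_const.mul
        (Complex.continuous_re.comp
          ((continuous_inner_toWeakSpace_symm _).comp continuous_fst)))).add continuous_const
    have h1 : Filter.Tendsto (fun e' : WeakSpace ℂ H × ℝ ↦ ‖w.symm e'.1 - w.symm e.1‖ ^ 2)
        (nhdsWithin e Y) (nhds 0) := by
      have h2 := (hc.tendsto e).mono_left (nhdsWithin_le_nhds (s := Y))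
      rw [← hq e he, sub_self, norm_zero, zero_pow two_ne_zero] at h2
      refine h2.congr' ?_
      filter_upwards [self_mem_nhdsWithin] with e' he'
      exact (hq e' he').symm
    have h3 := (Real.continuous_sqrt.tendsto 0).comp h1
    simpa [Function.comp_def, Real.sqrt_sq (norm_nonneg _)] using h3
  refine ⟨(fun e : WeakSpace ℂ H × ℝ ↦ w.symm e.1) '' Y,
    (hBc.of_isClosed_subset isClosed_closure hYB).image_of_continuousOn hcont, fun a ha ↦ ?_⟩
  exact ⟨T a e₀, subset_closure ⟨a, ha, rfl⟩, by simp [T, α]⟩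

section Rep
variable {Γ : Type*} [Group Γ]

/-- A unitary representation from a representation by norm-preserving linear maps. -/
def unitaryRepOfNorm {V : Type*} [SeminormedAddCommGroup V] [Module ℂ V] (σ : Γ →* Module.End ℂ V)
    (hσ : ∀ g v, ‖σ g v‖ = ‖v‖) : Γ →* (V ≃ₗᵢ[ℂ] V) where
  toFun g := ⟨LinearEquiv.ofLinearMap (σ g) (σ g⁻¹)
    (by rw [← Module.End.mul_eq_comp, ← map_mul]; simp; rfl)
    (by rw [← Module.End.mul_eq_comp, ← map_mul]; simp; rfl), hσ g⟩
  map_one' := by ext v; simp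
  map_mul' g h := by ext v; exact congrArg (fun f ↦ f v) (map_mul σ g h)

@[simp]
theorem unitaryRepOfNorm_apply {V : Type*} [SeminormedAddCommGroup V] [Module ℂ V]
    (σ : Γ →* Module.End ℂ V) (hσ : ∀ g v, ‖σ g v‖ = ‖v‖) (g : Γ) (v : V) :
    unitaryRepOfNorm σ hσ g v = σ g v := rfl

/-- The restriction of a unitary representation to an invariant subspace. -/
def unitarySubrep {H : Type*} [NormedAddCommGroup H] [InnerProductSpace ℂ H]
    (π : Γ →* (H ≃ₗᵢ[ℂ] H)) (L : Submodule ℂ H) (hL : ∀ g, ∀ v ∈ L, π g v ∈ L) :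
    Γ →* (L ≃ₗᵢ[ℂ] L) :=
  unitaryRepOfNorm
    { toFun := fun g ↦ ((π g).toLinearEquiv : H →ₗ[ℂ] H).restrict (hL g)
      map_one' := by ext; simp
      map_mul' := fun g h ↦ by ext; simp }
    fun g v ↦ (π g).norm_map v

@[simp]
theorem coe_unitarySubrep_apply {H : Type*} [NormedAddCommGroup H] [InnerProductSpace ℂ H]
    (π : Γ →* (H ≃ₗᵢ[ℂ] H)) (L : Submodule ℂ H) (hL : ∀ g, ∀ v ∈ L, π g v ∈ L) (g : Γ) (v : L) :
    (unitarySubrep π L hL g v : H) = π g v := rfl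

/-- A representation has almost invariant vectors. -/
def HasAlmostInvariant [Bornology Γ] {H : Type*} [NormedAddCommGroup H] [InnerProductSpace ℂ H]
    (π : Γ →* (H ≃ₗᵢ[ℂ] H)) : Prop :=
  ∀ A : Set Γ, Bornology.IsBounded A → ∀ ε : ℝ, 0 < ε → ∃ v : H, ‖v‖ = 1 ∧ ∀ a ∈ A, ‖π a v - v‖ < ε

theorem hasAlmostInvariant_of_ne_zero [Bornology Γ] {H : Type*} [NormedAddCommGroup H]
    [InnerProductSpace ℂ H] (π : Γ →* (H ≃ₗᵢ[ℂ] H))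
    (h : ∀ A : Set Γ, Bornology.IsBounded A → ∀ ε : ℝ, 0 < ε →
      ∃ v : H, v ≠ 0 ∧ ∀ a ∈ A, ‖π a v - v‖ < ε * ‖v‖) : HasAlmostInvariant π := by
  intro A hA ε hε
  obtain ⟨v, hv, hav⟩ := h A hA ε hε
  have hv' : 0 < ‖v‖ := norm_pos_iff.2 hv
  refine ⟨((‖v‖⁻¹ : ℝ) : ℂ) • v, by simp [norm_smul, hv'.ne'], fun a ha ↦ ?_⟩
  rw [map_smul, ← smul_sub, norm_smul, Complex.norm_real, norm_inv, norm_norm,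
    inv_mul_lt_iff₀ hv', mul_comm]
  exact hav a ha

end Rep

/-- Coarse property (T) tested on Hilbert spaces in a fixed universe. -/
def CoarseT.{w, u} (Γ : Type u) [Group Γ] [Bornology Γ] : Prop :=
  ∀ (H : Type w) [NormedAddCommGroup H] [InnerProductSpace ℂ H] [CompleteSpace H]
    (π : Γ →* (H ≃ₗᵢ[ℂ] H)), HasAlmostInvariant π → ∃ v : H, v ≠ 0 ∧ ∀ g : Γ, π g v = v

open TopologicalSpace in
theorem Orthonormal.countable_of_separable {L ι : Type*} [NormedAddCommGroup L]
    [InnerProductSpace ℂ L] [SeparableSpace L] {b : ι → L} (hb : Orthonormal ℂ b) :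
    Countable ι := by
  refine Pairwise.countable_of_isOpen_disjoint (s := fun i ↦ Metric.ball (b i) (1 / 2)) ?_
    (fun i ↦ Metric.isOpen_ball) fun i ↦ ⟨b i, Metric.mem_ball_self (by norm_num)⟩
  intro i j hij
  refine Metric.ball_disjoint_ball ?_
  rw [dist_eq_norm]
  have h : ‖b i - b j‖ ^ 2 = 2 := by
    rw [@norm_sub_sq ℂ, hb.2 hij, hb.1, hb.1]; norm_num
  nlinarith [norm_nonneg (b i - b j)]

open TopologicalSpace in
theorem exists_linearIsometryEquiv_lp.{v, u} (L : Type u) [NormedAddCommGroup L]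
    [InnerProductSpace ℂ L] [CompleteSpace L] [SeparableSpace L] :
    ∃ ι : Type v, Nonempty (L ≃ₗᵢ[ℂ] lp (fun _ : ι ↦ ℂ) 2) := by
  obtain ⟨w, b, -⟩ := exists_hilbertBasis ℂ L
  have : Countable w := b.orthonormal.countable_of_separable
  have : Small.{v} w := Countable.toSmall _
  refine ⟨Shrink.{v} w, ⟨HilbertBasis.repr (HilbertBasis.mk (𝕜 := ℂ) (E := L) (ι := Shrink.{v} w)
    (v := b ∘ (equivShrink.{v} w).symm)
    (b.orthonormal.comp _ (equivShrink.{v} w).symm.injective) ?_)⟩⟩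
  rw [(equivShrink w).symm.surjective.range_comp, b.dense_span]

theorem exists_generating_with_one {Γ : Type*} [Group Γ] [Bornology Γ]
    (hgen : ∃ S : Set Γ, Bornology.IsBounded S ∧
      ∀ C : Set Γ, Bornology.IsBounded C → ∃ n : ℕ, C ⊆ S ^ n) :
    ∃ S : Set Γ, 1 ∈ S ∧ Bornology.IsBounded S ∧
      ∀ C : Set Γ, Bornology.IsBounded C → ∃ n : ℕ, C ⊆ S ^ n := by
  obtain ⟨S, hS, h⟩ := hgen
  refine ⟨insert 1 S, by simp, hS.insert 1, fun C hC ↦ ?_⟩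
  obtain ⟨n, hn⟩ := h C hC
  exact ⟨n, hn.trans (Set.pow_subset_pow_left (Set.subset_insert 1 S))⟩

theorem Bornology.isBounded_group_pow {Γ : Type*} [Group Γ] [Bornology Γ]
    (hmul : ∀ A B : Set Γ, Bornology.IsBounded A → Bornology.IsBounded B →
      Bornology.IsBounded (A * B)) {S : Set Γ} (hS : Bornology.IsBounded S) (n : ℕ) :
    Bornology.IsBounded (S ^ n) := by
  induction n with
  | zero => rw [pow_zero]; exact Bornology.isBounded_singleton
  | succ n ih => rw [pow_succ]; exact hmul _ _ ih hS

theorem exists_covering_with_one {Γ : Type*} [Group Γ] [Bornology Γ]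
    (hbg : ∃ C : Set Γ, Bornology.IsBounded C ∧ ∀ A : Set Γ, Bornology.IsBounded A →
      ∃ t : Finset Γ, A ⊆ ⋃ g ∈ t, g • C) :
    ∃ C : Set Γ, 1 ∈ C ∧ Bornology.IsBounded C ∧ ∀ A : Set Γ, Bornology.IsBounded A →
      ∃ t : Finset Γ, A ⊆ ⋃ g ∈ t, g • C := by
  obtain ⟨C, hC, h⟩ := hbg
  refine ⟨insert 1 C, by simp, hC.insert 1, fun A hA ↦ ?_⟩
  obtain ⟨t, ht⟩ := h A hA
  exact ⟨t, ht.trans (Set.iUnion₂_mono fun g _ ↦ Set.smul_set_mono (Set.subset_insert 1 C))⟩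

open TopologicalSpace in
/-- Coarse property (T) does not depend on the universe of the Hilbert spaces. -/
theorem CoarseT.change_universe.{v, u, w} {Γ : Type w} [Group Γ] [Bornology Γ]
    (hmul : ∀ A B : Set Γ, Bornology.IsBounded A → Bornology.IsBounded B →
      Bornology.IsBounded (A * B))
    (hbg : ∃ C : Set Γ, Bornology.IsBounded C ∧ ∀ A : Set Γ, Bornology.IsBounded A →
      ∃ t : Finset Γ, A ⊆ ⋃ g ∈ t, g • C)
    (hgen : ∃ S : Set Γ, Bornology.IsBounded S ∧
      ∀ C : Set Γ, Bornology.IsBounded C → ∃ n : ℕ, C ⊆ S ^ n)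
    (hT : CoarseT.{v} Γ) : CoarseT.{u} Γ := by
  intro H _ _ _ π hπ
  obtain ⟨S, hS1, hS, hSgen⟩ := exists_generating_with_one hgen
  obtain ⟨C, hC1, hC, hCcov⟩ := exists_covering_with_one hbg
  have hpow : ∀ n, Bornology.IsBounded (S ^ n) := Bornology.isBounded_group_pow hmul hS
  have key : ∀ n : ℕ, ∃ y : H, y ≠ 0 ∧ (∀ a ∈ S ^ n, ‖π a y - y‖ ≤ 6 * (1 / (n + 2)) * ‖y‖) ∧
      ∀ A : Set Γ, Bornology.IsBounded A → ∃ K : Set H, IsCompact K ∧ ∀ a ∈ A, π a y ∈ K := by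
    intro n
    have hε : (0 : ℝ) < 1 / (n + 2) := by positivity
    obtain ⟨v, hv, hav⟩ := hπ (S ^ n ∪ C) ((hpow n).union hC) _ hε
    obtain ⟨y, hyv, hy⟩ := exists_isCompact_orbit π (fun _ ↦ 0) (by simp) ⟨1, hC1⟩ v (1 / (n + 2))
      (fun c hc ↦ by simpa using (hav c (Or.inr hc)).le)
    have hε' : (1 : ℝ) / (n + 2) ≤ 1 / 2 := by
      apply one_div_le_one_div_of_le <;> norm_num
    have hy2 : 1 / 2 ≤ ‖y‖ := by
      have := norm_sub_norm_le v y
      rw [norm_sub_rev] at this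
      linarith
    refine ⟨y, norm_pos_iff.1 (by linarith), fun a ha ↦ ?_, fun A hA ↦ ?_⟩
    · have h1 : π a y - y = π a (y - v) + (π a v - v) - (y - v) := by rw [map_sub]; abel
      have h2 : ‖π a y - y‖ ≤ ‖y - v‖ + ‖π a v - v‖ + ‖y - v‖ := by
        rw [h1]
        refine (norm_sub_le _ _).trans (add_le_add_left ((norm_add_le _ _).trans ?_) _)
        rw [LinearIsometryEquiv.norm_map]
      have := (hav a (Or.inl ha)).le
      nlinarith
    · obtain ⟨t, ht⟩ := hCcov _ (hmul A C hA hC)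
      obtain ⟨K, hK, h⟩ := hy A t ht
      exact ⟨K, hK, by simpa using h⟩
  choose y hy0 hydisp hycpt using key
  let O : Set H := ⋃ n, Set.range fun g ↦ π g (y n)
  let L : Submodule ℂ H := (Submodule.span ℂ O).topologicalClosure
  have hO : IsSeparable O := by
    refine .iUnion fun n ↦ ?_
    have : (Set.range fun g ↦ π g (y n)) ⊆ ⋃ k : ℕ, (fun g ↦ π g (y n)) '' (S ^ k) := by
      rintro _ ⟨g, rfl⟩
      obtain ⟨k, hk⟩ := hSgen {g} Bornology.isBounded_singleton
      exact Set.mem_iUnion.2 ⟨k, g, hk rfl, rfl⟩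
    refine (IsSeparable.iUnion fun k ↦ ?_).mono this
    obtain ⟨K, hK, h⟩ := hycpt n _ (hpow k)
    exact hK.isSeparable.mono (by rintro _ ⟨g, hg, rfl⟩; exact h g hg)
  have hLsep : IsSeparable (L : Set H) := (hO.span).closure
  have : SeparableSpace L := hLsep.separableSpace
  have hLc : IsClosed (L : Set H) := Submodule.isClosed_topologicalClosure _
  have : CompleteSpace L := hLc.completeSpace_coe
  have hyL : ∀ n, y n ∈ L := fun n ↦
    Submodule.le_topologicalClosure _ (Submodule.subset_span (Set.mem_iUnion.2 ⟨n, 1, by simp⟩))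
  have hspan : ∀ g, ∀ v ∈ Submodule.span ℂ O, π g v ∈ Submodule.span ℂ O := by
    intro g v hv
    induction hv using Submodule.span_induction with
    | mem x hx =>
      obtain ⟨n, h, rfl⟩ := Set.mem_iUnion.1 hx
      exact Submodule.subset_span (Set.mem_iUnion.2 ⟨n, g * h, by simp⟩)
    | zero => simp
    | add x y _ _ hx hy => rw [map_add]; exact add_mem hx hy
    | smul c x _ hx => rw [map_smul]; exact Submodule.smul_mem _ _ hx
  have hL : ∀ g, ∀ v ∈ L, π g v ∈ L := fun g v hv ↦
    map_mem_closure (π g).continuous hv (hspan g)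
  obtain ⟨ι, ⟨e⟩⟩ := exists_linearIsometryEquiv_lp.{v} L
  let ρ := unitarySubrep π L hL
  let ρ' : Γ →* (lp (fun _ : ι ↦ ℂ) 2 ≃ₗᵢ[ℂ] lp (fun _ : ι ↦ ℂ) 2) :=
    { toFun := fun g ↦ (e.symm.trans (ρ g)).trans e
      map_one' := by ext1 v; simp
      map_mul' := fun g h ↦ by ext1 v; simp }
  obtain ⟨v, hv0, hv⟩ := hT _ ρ' <| by
    refine hasAlmostInvariant_of_ne_zero _ fun A hA ε hε ↦ ?_
    obtain ⟨k, hk⟩ := hSgen A hA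
    obtain ⟨m, hm⟩ := exists_nat_gt (6 / ε)
    let n := max k m
    refine ⟨e ⟨y n, hyL n⟩, fun h ↦
      hy0 n (congrArg Subtype.val ((map_eq_zero_iff e e.injective).1 h)), fun a ha ↦ ?_⟩
    have h1 : ρ' a (e ⟨y n, hyL n⟩) - e ⟨y n, hyL n⟩ = e (ρ a ⟨y n, hyL n⟩ - ⟨y n, hyL n⟩) := by
      simp [ρ']
    rw [h1, LinearIsometryEquiv.norm_map, LinearIsometryEquiv.norm_map]
    refine (hydisp n a (Set.pow_subset_pow_right hS1 (le_max_left k m) (hk ha))).trans_lt ?_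
    refine mul_lt_mul_of_pos_right ?_ (norm_pos_iff.2 (hy0 n))
    have hmn : (m : ℝ) ≤ n := by exact_mod_cast le_max_right k m
    rw [mul_one_div, div_lt_iff₀ (by positivity)]
    rw [div_lt_iff₀ hε] at hm
    nlinarith
  refine ⟨(e.symm v : H), by simpa using hv0, fun g ↦ ?_⟩
  have := congrArg e.symm (hv g)
  simpa [ρ', ρ] using congrArg Subtype.val this

section PosSemidef
open scoped ComplexOrder
open Filter Topology

theorem Matrix.PosSemidef.of_tendsto {X : Type*} {M : ℕ → Matrix X X ℂ} {N : Matrix X X ℂ}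
    (hM : ∀ n, (M n).PosSemidef) (h : ∀ i j, Tendsto (fun n ↦ M n i j) atTop (𝓝 (N i j))) :
    N.PosSemidef := by
  refine ⟨Matrix.IsHermitian.ext fun i j ↦ ?_, fun x ↦ ?_⟩
  · refine tendsto_nhds_unique (((Complex.continuous_conj.tendsto _).comp (h j i)).congr
      fun n ↦ ?_) (h i j)
    exact (hM n).isHermitian.apply i j
  · refine ge_of_tendsto' (x := atTop) (f := fun n ↦ x.sum fun i xi ↦ x.sum fun j xj ↦
      star xi * M n i j * xj) ?_ fun n ↦ (hM n).2 x
    exact tendsto_finsetSum _ fun i _ ↦ tendsto_finsetSum _ fun j _ ↦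
      ((h i j).const_mul _).mul_const _

theorem Matrix.posSemidef_inner {X K : Type*} [NormedAddCommGroup K] [InnerProductSpace ℂ K]
    (β : X → K) : (Matrix.of fun i j : X ↦ inner ℂ (β i) (β j)).PosSemidef := by
  refine ⟨Matrix.IsHermitian.ext fun i j ↦ inner_conj_symm _ _, fun x ↦ ?_⟩
  have : (x.sum fun i xi ↦ x.sum fun j xj ↦
      star xi * Matrix.of (fun i j : X ↦ inner ℂ (β i) (β j)) i j * xj) =
      inner ℂ (x.sum fun i xi ↦ xi • β i) (x.sum fun i xi ↦ xi • β i) := by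
    simp only [Finsupp.sum, sum_inner, inner_sum, inner_smul_left, inner_smul_right,
      Matrix.of_apply, Complex.star_def]
    simp only [Finset.mul_sum]
    rw [Finset.sum_comm]
    refine Finset.sum_congr rfl fun i _ ↦ Finset.sum_congr rfl fun j _ ↦ ?_
    ring
  rw [this, inner_self_eq_norm_sq_to_K]
  rw [← RCLike.ofReal_pow]
  exact RCLike.ofReal_nonneg.2 (sq_nonneg _)

theorem Matrix.PosSemidef.map_pow {X : Type*} {M : Matrix X X ℂ} (hM : M.PosSemidef) (k : ℕ) :
    (M.map (· ^ k)).PosSemidef := by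
  induction k with
  | zero =>
    have : M.map (· ^ 0) = Matrix.of fun _ _ : X ↦ inner ℂ (1 : ℂ) 1 := by ext; simp
    rw [this]
    exact Matrix.posSemidef_inner _
  | succ k ih =>
    have : M.map (· ^ (k + 1)) = (M.map (· ^ k)).hadamard M := by ext; simp [pow_succ]
    rw [this]
    exact ih.hadamard hM

theorem Matrix.PosSemidef.map_exp {X : Type*} {M : Matrix X X ℂ} (hM : M.PosSemidef) :
    (M.map Complex.exp).PosSemidef := by
  refine .of_tendsto (M := fun n ↦ ∑ k ∈ Finset.range n, ((k.factorial : ℂ)⁻¹) • M.map (· ^ k))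
    (fun n ↦ ?_) fun i j ↦ ?_
  · induction n with
    | zero => simpa using Matrix.PosSemidef.zero
    | succ n ih =>
      rw [Finset.sum_range_succ]
      refine ih.add ((hM.map_pow n).smul ?_)
      exact inv_nonneg.2 (Nat.cast_nonneg _)
  · have := (NormedSpace.expSeries_div_hasSum_exp (M i j)).tendsto_sum_nat
    rw [← Complex.exp_eq_exp_ℂ] at this
    refine this.congr fun n ↦ ?_
    simp [Matrix.sum_apply, div_eq_inv_mul]

theorem Matrix.posSemidef_gaussian {X K : Type*} [NormedAddCommGroup K] [InnerProductSpace ℂ K]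
    (β : X → K) :
    (Matrix.of fun i j : X ↦ ((Real.exp (-‖β i - β j‖ ^ 2) : ℝ) : ℂ)).PosSemidef := by
  have hg := Matrix.posSemidef_inner β
  have : (Matrix.of fun i j : X ↦ ((Real.exp (-‖β i - β j‖ ^ 2) : ℝ) : ℂ)) =
      ((((Matrix.of fun i j : X ↦ inner ℂ (β i) (β j)).map Complex.exp).hadamard
        ((Matrix.of fun i j : X ↦ inner ℂ (β i) (β j)).transpose.map Complex.exp)).hadamard
      (Matrix.of fun i j : X ↦ inner ℂ ((Real.exp (-‖β i‖ ^ 2) : ℝ) : ℂ)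
        ((Real.exp (-‖β j‖ ^ 2) : ℝ) : ℂ))) := by
    ext i j
    simp only [Matrix.of_apply, Matrix.hadamard_apply, Matrix.map_apply,
      Matrix.transpose_apply, RCLike.inner_apply, Complex.conj_ofReal]
    rw [← Complex.exp_add, ← inner_conj_symm (β j) (β i), Complex.add_conj,
      ← Complex.ofReal_exp, ← Complex.ofReal_mul, ← Complex.ofReal_mul, ← Real.exp_add,
      ← Real.exp_add, @norm_sub_sq ℂ]
    congr 2
    simp only [RCLike.re_to_complex]
    ring
  rw [this]
  exact (hg.map_exp.hadamard hg.transpose.map_exp).hadamard (Matrix.posSemidef_inner _)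

end PosSemidef

open UniformSpace in
/-- A group of inner-product-preserving operators on a space with a positive semidefinite
sesquilinear form extends to a unitary representation on the separated completion. -/
theorem exists_unitaryRep_completion.{u, w} {Γ : Type w} [Group Γ] {V : Type u} [AddCommGroup V]
    [Module ℂ V] (c : PreInnerProductSpace.Core ℂ V) (ρ : Γ →* Module.End ℂ V)
    (hρ : ∀ g x y, c.inner (ρ g x) (ρ g y) = c.inner x y) :
    ∃ (K : Type u) (_ : NormedAddCommGroup K) (_ : InnerProductSpace ℂ K) (_ : CompleteSpace K)
      (j : V →ₗ[ℂ] K) (π : Γ →* (K ≃ₗᵢ[ℂ] K)), DenseRange j ∧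
      (∀ x y, inner ℂ (j x) (j y) = c.inner x y) ∧ ∀ g x, π g (j x) = j (ρ g x) := by
  let := c
  let : SeminormedAddCommGroup V := InnerProductSpace.Core.toSeminormedAddCommGroup (𝕜 := ℂ)
  let : InnerProductSpace ℂ V := .ofCore c
  have hinner : ∀ x y : V, inner ℂ x y = c.inner x y := fun _ _ ↦ rfl
  have hnorm : ∀ g (x : V), ‖ρ g x‖ = ‖x‖ := fun g x ↦ by
    rw [@norm_eq_sqrt_re_inner ℂ, @norm_eq_sqrt_re_inner ℂ _ _ _ _ x, hinner, hinner, hρ]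
  let σ : Γ → V →L[ℂ] V := fun g ↦ (ρ g).mkContinuous 1 fun x ↦ by rw [hnorm, one_mul]
  let τ : Γ →* Module.End ℂ (Completion V) :=
    { toFun := fun g ↦ ((σ g).completion : Completion V →ₗ[ℂ] Completion V)
      map_one' := by
        ext x
        induction x using Completion.induction_on with
        | hp => exact isClosed_eq (σ 1).completion.continuous continuous_id
        | ih x =>
          refine ((σ 1).completion_apply_coe x).trans ?_
          simp [σ]
      map_mul' := fun g h ↦ by
        ext x
        induction x using Completion.induction_on with
        | hp =>
          exact isClosed_eq (σ (g * h)).completion.continuous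
            ((σ g).completion.continuous.comp (σ h).completion.continuous)
        | ih x =>
          refine ((σ (g * h)).completion_apply_coe x).trans ?_
          show _ = (σ g).completion ((σ h).completion x)
          rw [(σ h).completion_apply_coe, (σ g).completion_apply_coe]
          simp [σ] }
  have hτ : ∀ g (x : V), τ g (x : Completion V) = ((ρ g x : V) : Completion V) := fun g x ↦
    (σ g).completion_apply_coe x
  have hτn : ∀ g x, ‖τ g x‖ = ‖x‖ := by
    intro g x
    induction x using Completion.induction_on with
    | hp => exact isClosed_eq (σ g).completion.continuous.norm continuous_norm
    | ih x => rw [hτ, Completion.norm_coe, Completion.norm_coe, hnorm]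
  exact ⟨Completion V, inferInstance, inferInstance, inferInstance,
    (Completion.toComplₗᵢ (𝕜 := ℂ) (E := V)).toLinearMap, unitaryRepOfNorm τ hτn,
    Completion.denseRange_coe, fun x y ↦ Completion.inner_coe x y, hτ⟩

open scoped ComplexOrder in
/-- The Gelfand-Naimark-Segal construction for an invariant positive semidefinite kernel. -/
theorem exists_unitaryRep_of_posSemidef.{u, w} {Γ : Type w} [Group Γ] {X : Type u} [MulAction Γ X]
    {M : Matrix X X ℂ} (hM : M.PosSemidef) (hinv : ∀ (g : Γ) x y, M (g • x) (g • y) = M x y) :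
    ∃ (K : Type u) (_ : NormedAddCommGroup K) (_ : InnerProductSpace ℂ K) (_ : CompleteSpace K)
      (ξ : X → K) (π : Γ →* (K ≃ₗᵢ[ℂ] K)), (∀ x y, inner ℂ (ξ x) (ξ y) = M x y) ∧
      ∀ g x, π g (ξ x) = ξ (g • x) := by
  let c : PreInnerProductSpace.Core ℂ (X →₀ ℂ) :=
    { inner := fun f g ↦ f.sum fun i z ↦ g.sum fun j w ↦ star z * M i j * w
      conj_inner_symm := fun f g ↦ by
        rw [Finsupp.sum_comm]
        simp only [map_finsuppSum]
        congr! 6 with i z j w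
        rw [← hM.isHermitian.apply]
        simp [mul_assoc, mul_comm]
      add_left := fun x y z ↦ by
        rw [Finsupp.sum_add_index'] <;> simp [← Finsupp.sum_add, add_mul]
      smul_left := fun x y r ↦ by
        rw [Finsupp.sum_smul_index] <;> simp [Finsupp.mul_sum, ← mul_assoc]
      re_inner_nonneg := fun x ↦ (Complex.nonneg_iff.1 (hM.2 x)).1 }
  let ρ : Γ →* Module.End ℂ (X →₀ ℂ) :=
    { toFun := fun g ↦ Finsupp.lmapDomain ℂ ℂ (g • ·)
      map_one' := by ext x; simp
      map_mul' := fun g h ↦ by ext x; simp [mul_smul] }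
  have hρ : ∀ g x y, c.inner (ρ g x) (ρ g y) = c.inner x y := by
    intro g x y
    show (Finsupp.mapDomain (g • ·) x).sum (fun i z ↦ (Finsupp.mapDomain (g • ·) y).sum
      fun j w ↦ star z * M i j * w) = x.sum fun i z ↦ y.sum fun j w ↦ star z * M i j * w
    rw [Finsupp.sum_mapDomain_index (by simp) (by simp [add_mul])]
    congr! 2 with i
    funext z
    rw [Finsupp.sum_mapDomain_index (by simp) (by simp [mul_add])]
    simp only [hinv]
  obtain ⟨K, i₁, i₂, i₃, j, π, -, hj, hπ⟩ := exists_unitaryRep_completion c ρ hρ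
  refine ⟨K, i₁, i₂, i₃, fun x ↦ j (Finsupp.single x 1), π, fun x y ↦ ?_, fun g x ↦ ?_⟩
  · rw [hj]
    show (Finsupp.single x (1 : ℂ)).sum (fun i z ↦ (Finsupp.single y (1 : ℂ)).sum
      fun j w ↦ star z * M i j * w) = _
    simp
  · rw [hπ]; simp [ρ]

/-- The subspace of invariant vectors of a unitary representation. -/
def invariantVectors {Γ H : Type*} [Group Γ] [NormedAddCommGroup H] [InnerProductSpace ℂ H]
    (π : Γ →* (H ≃ₗᵢ[ℂ] H)) : Submodule ℂ H where
  carrier := {v | ∀ g, π g v = v}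
  add_mem' := fun ha hb g ↦ by rw [map_add, ha g, hb g]
  zero_mem' := fun g ↦ map_zero _
  smul_mem' := fun c v hv g ↦ by rw [map_smul, hv g]

theorem mem_invariantVectors {Γ H : Type*} [Group Γ] [NormedAddCommGroup H]
    [InnerProductSpace ℂ H] {π : Γ →* (H ≃ₗᵢ[ℂ] H)} {v : H} :
    v ∈ invariantVectors π ↔ ∀ g, π g v = v := Iff.rfl

theorem isClosed_invariantVectors {Γ H : Type*} [Group Γ] [NormedAddCommGroup H]
    [InnerProductSpace ℂ H] (π : Γ →* (H ≃ₗᵢ[ℂ] H)) :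
    IsClosed (invariantVectors π : Set H) := by
  have : (invariantVectors π : Set H) = ⋂ g, {v | π g v = v} := by
    ext v; simp [mem_invariantVectors]
  rw [this]
  exact isClosed_iInter fun g ↦ isClosed_eq (π g).continuous continuous_id

/-- Property (T) forces displacement to control the distance to the invariant vectors. -/
theorem CoarseT.exists_kazhdan_pair.{v, w} {Γ : Type w} [Group Γ] [Bornology Γ]
    (hT : CoarseT.{v} Γ) {H : Type v} [NormedAddCommGroup H] [InnerProductSpace ℂ H]
    [CompleteSpace H] (π : Γ →* (H ≃ₗᵢ[ℂ] H)) :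
    ∃ A : Set Γ, Bornology.IsBounded A ∧ ∃ ε : ℝ, 0 < ε ∧ ∀ (v : H) (η : ℝ), 0 ≤ η →
      (∀ a ∈ A, ‖π a v - v‖ < ε * η) → ∀ g, ‖π g v - v‖ ≤ 2 * η := by
  let I := invariantVectors π
  have : CompleteSpace I := (isClosed_invariantVectors π).completeSpace_coe
  have hL : ∀ g, ∀ v ∈ Iᗮ, π g v ∈ Iᗮ := by
    intro g v hv w hw
    have h : π g w = w := hw g
    rw [← h, LinearIsometryEquiv.inner_map_map]
    exact hv w hw
  have hnot : ¬ HasAlmostInvariant (unitarySubrep π Iᗮ hL) := by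
    intro h
    obtain ⟨v, hv0, hv⟩ := hT _ _ h
    refine hv0 (Subtype.ext ?_)
    have h1 : (v : H) ∈ I := fun g ↦ congrArg Subtype.val (hv g)
    exact inner_self_eq_zero.1 (v.2 v h1)
  have := mt (hasAlmostInvariant_of_ne_zero _) hnot
  push Not at this
  obtain ⟨A, hA, ε, hε, h⟩ := this
  refine ⟨A, hA, ε, hε, fun v η hη hv g ↦ ?_⟩
  obtain ⟨i, hi, k, hk, rfl⟩ := I.exists_add_mem_mem_orthogonal v
  have hd : ∀ g, π g (i + k) - (i + k) = π g k - k := fun g ↦ by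
    rw [map_add, hi g]; abel
  have hkη : ‖k‖ ≤ η := by
    by_cases h0 : k = 0
    · simpa [h0] using hη
    · obtain ⟨a, ha, hak⟩ := h ⟨k, hk⟩ (by simpa using h0)
      have h1 := hv a ha
      rw [hd] at h1
      change ε * ‖k‖ ≤ ‖π a k - k‖ at hak
      nlinarith
  rw [hd]
  calc ‖π g k - k‖ ≤ ‖π g k‖ + ‖k‖ := norm_sub_le _ _
    _ ≤ 2 * η := by rw [LinearIsometryEquiv.norm_map]; linarith

open scoped ComplexOrder in
/-- The Delorme direction of the Delorme-Guichardet theorem, for equivariant kernels. -/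
theorem CoarseT.exists_norm_sub_le.{w} {Q : Type w} [Group Q] [Bornology Q]
    (hT : CoarseT.{w} Q) {K : Type*} [NormedAddCommGroup K] [InnerProductSpace ℂ K] (β : Q → K)
    (hβ : ∀ r q q', ‖β (r * q) - β (r * q')‖ = ‖β q - β q'‖)
    (hbd : ∀ A : Set Q, Bornology.IsBounded A → ∃ B : ℝ, ∀ a ∈ A, ‖β a - β 1‖ ≤ B) :
    ∃ R : ℝ, ∀ q, ‖β q - β 1‖ ≤ R := by
  let _ : MulAction Q (ℕ × Q) :=
    { smul := fun r x ↦ (x.1, r * x.2)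
      one_smul := fun x ↦ Prod.ext rfl (one_mul x.2)
      mul_smul := fun r s x ↦ Prod.ext rfl (mul_assoc r s x.2) }
  have hsmul : ∀ (r : Q) (x : ℕ × Q), r • x = (x.1, r * x.2) := fun _ _ ↦ rfl
  let c : ℕ → ℂ := fun n ↦ ((1 / Real.sqrt (n + 1) : ℝ) : ℂ)
  have hc : ∀ (n : ℕ) (x : K), ‖c n • x‖ ^ 2 = ‖x‖ ^ 2 / (n + 1) := fun n x ↦ by
    rw [norm_smul, mul_pow, Complex.norm_real, Real.norm_eq_abs, sq_abs, div_pow,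
      Real.sq_sqrt (by positivity)]
    ring
  have hM := (Matrix.posSemidef_gaussian fun x : ℕ × Q ↦ c x.1 • β x.2).hadamard
    ((Matrix.PosSemidef.one (n := ℕ) (R := ℂ)).submatrix (Prod.fst : ℕ × Q → ℕ))
  obtain ⟨H, _, _, _, ξ, π, hξ, hπ⟩ := exists_unitaryRep_of_posSemidef (Γ := Q) hM <| by
    intro g x y
    simp only [hsmul, Matrix.hadamard_apply, Matrix.of_apply, Matrix.submatrix_apply]
    by_cases hxy : x.1 = y.1
    · rw [hxy, ← smul_sub, ← smul_sub, hc, hc, hβ]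
    · simp [hxy]
  have hinner : ∀ n q q', inner ℂ (ξ (n, q)) (ξ (n, q')) =
      ((Real.exp (-(‖β q - β q'‖ ^ 2 / (n + 1))) : ℝ) : ℂ) := fun n q q' ↦ by
    rw [hξ]
    simp only [Matrix.hadamard_apply, Matrix.of_apply, Matrix.submatrix_apply,
      Matrix.one_apply_eq, mul_one]
    rw [← smul_sub, hc]
  have hnorm : ∀ n q, ‖ξ (n, q)‖ ^ 2 = 1 := fun n q ↦ by
    rw [← @inner_self_eq_norm_sq ℂ, hinner]; simp
  have hdisp : ∀ n q, ‖π q (ξ (n, 1)) - ξ (n, 1)‖ ^ 2 =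
      2 - 2 * Real.exp (-(‖β q - β 1‖ ^ 2 / (n + 1))) := fun n q ↦ by
    rw [hπ, hsmul, mul_one, @norm_sub_sq ℂ, hnorm, hnorm, hinner, RCLike.re_to_complex,
      Complex.ofReal_re]
    ring
  obtain ⟨A, hA, ε, hε, h⟩ := hT.exists_kazhdan_pair π
  obtain ⟨B, hB⟩ := hbd A hA
  obtain ⟨n, hn⟩ := exists_nat_gt (2 * B ^ 2 / (ε / 4) ^ 2)
  have key := h (ξ (n, 1)) (1 / 4) (by norm_num) fun a ha ↦ by
    refine lt_of_pow_lt_pow_left₀ 2 (by positivity) ?_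
    rw [hdisp]
    have h1 := Real.add_one_le_exp (-(‖β a - β 1‖ ^ 2 / (n + 1)))
    have h2 : ‖β a - β 1‖ ^ 2 ≤ B ^ 2 := pow_le_pow_left₀ (norm_nonneg _) (hB a ha) 2
    have h3 : 2 * (‖β a - β 1‖ ^ 2 / (n + 1)) < (ε / 4) ^ 2 := by
      rw [mul_div_assoc', div_lt_iff₀ (by positivity)]
      rw [div_lt_iff₀ (by positivity)] at hn
      nlinarith [sq_pos_of_pos (show 0 < ε / 4 by positivity)]
    calc _ ≤ 2 * (‖β a - β 1‖ ^ 2 / (n + 1)) := by linarith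
      _ < _ := by rw [mul_one_div]; exact h3
  refine ⟨n + 1, fun q ↦ ?_⟩
  have h1 := pow_le_pow_left₀ (norm_nonneg _) (key q) 2
  rw [hdisp] at h1
  have h2 : ‖β q - β 1‖ ^ 2 / (n + 1) ≤ 1 := by
    by_contra! h3
    have h4 := Real.exp_lt_exp.2 (neg_lt_neg h3)
    have h5 : Real.exp (-1) < 1 / 2 := by
      rw [Real.exp_neg, inv_lt_comm₀ (Real.exp_pos 1) (by norm_num)]
      have := Real.exp_one_gt_d9
      norm_num at this ⊢
      linarith
    linarith
  rw [div_le_one (by positivity)] at h2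
  have hn0 : (0 : ℝ) ≤ n := Nat.cast_nonneg n
  nlinarith [norm_nonneg (β q - β 1)]

/-- An isometric affine action with bounded orbits almost fixes a point. -/
theorem exists_almost_fixed_of_bounded_cocycle {Γ H : Type*} [Group Γ] [NormedAddCommGroup H]
    [InnerProductSpace ℂ H] (π : Γ →* (H ≃ₗᵢ[ℂ] H)) (b : Γ → H)
    (hb : ∀ g h, b (g * h) = b g + π g (b h)) {R : ℝ} (hR : ∀ g, ‖b g‖ ≤ R) {ε : ℝ}
    (hε : 0 < ε) : ∃ x : H, ∀ g, ‖π g x + b g - x‖ ≤ ε := by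
  let T : Set ℝ := {r | ∃ x : H, ∀ g, ‖x - b g‖ ^ 2 ≤ r}
  have hT0 : BddBelow T := ⟨0, fun r ⟨x, hx⟩ ↦ (sq_nonneg _).trans (hx 1)⟩
  have hTn : T.Nonempty := ⟨R ^ 2, 0, fun g ↦ by
    rw [zero_sub, norm_neg]; exact pow_le_pow_left₀ (norm_nonneg _) (hR g) 2⟩
  obtain ⟨r, ⟨x, hx⟩, hr⟩ := exists_lt_of_csInf_lt hTn
    (lt_add_of_pos_right (sInf T) (show 0 < ε ^ 2 / 4 by positivity))
  refine ⟨x, fun h ↦ ?_⟩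
  set x' := π h x + b h with hx'
  have h1 : ∀ g, ‖x' - b g‖ ^ 2 ≤ r := fun g ↦ by
    have h2 : x' - b g = π h (x - b (h⁻¹ * g)) := by
      have := hb h (h⁻¹ * g)
      rw [mul_inv_cancel_left] at this
      rw [this, hx', map_sub]; abel
    rw [h2, LinearIsometryEquiv.norm_map]
    exact hx _
  have hmem : r - ‖x' - x‖ ^ 2 / 4 ∈ T := by
    refine ⟨(1 / 2 : ℂ) • (x + x'), fun g ↦ ?_⟩
    have h2 := parallelogram_law_with_norm ℂ (x - b g) (x' - b g)
    have h3 : x - b g - (x' - b g) = -(x' - x) := by abel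
    have h4 : x - b g + (x' - b g) = (2 : ℂ) • ((1 / 2 : ℂ) • (x + x') - b g) := by
      rw [smul_sub, smul_smul]; norm_num [two_smul]; abel
    rw [h3, h4, norm_neg, norm_smul] at h2
    norm_num at h2
    have := hx g
    have := h1 g
    norm_num
    nlinarith
  have := csInf_le hT0 hmem
  exact le_of_sq_le_sq (by linarith) hε.le

/-- Point-picking: if a representation has almost invariant but no invariant vectors, then there
are vectors with almost minimal displacement on arbitrarily large balls at their own scale. -/
theorem exists_displacement_almost_minimal {G H : Type*} [Group G] [NormedAddCommGroup H]
    [InnerProductSpace ℂ H] [CompleteSpace H] (π : G →* (H ≃ₗᵢ[ℂ] H)) {S : Set G}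
    (hS : S.Nonempty) (hinv : ∀ v, (∀ s ∈ S, π s v = v) → v = 0)
    (hai : ∀ ε : ℝ, 0 < ε → ∃ v : H, ‖v‖ = 1 ∧ ∀ s ∈ S, ‖π s v - v‖ < ε) {R : ℝ} (hR : 0 < R) :
    ∃ (v : H) (d : ℝ), 0 < d ∧ (∀ s ∈ S, ‖π s v - v‖ ≤ d) ∧
      ∀ x, ‖x - v‖ ≤ R * d → ∃ s ∈ S, d / 4 ≤ ‖π s x - x‖ := by
  have : Nonempty S := hS.to_subtype
  let δ : H → ℝ := fun v ↦ ⨆ s : S, ‖π s v - v‖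
  have hle : ∀ v, ∀ s ∈ S, ‖π s v - v‖ ≤ δ v := fun v s hs ↦ by
    refine le_ciSup (f := fun s : S ↦ ‖π s v - v‖) ⟨2 * ‖v‖, ?_⟩ ⟨s, hs⟩
    rintro _ ⟨s, rfl⟩
    refine (norm_sub_le _ _).trans ?_
    rw [LinearIsometryEquiv.norm_map, two_mul]
  have hlt : ∀ v c, c < δ v → ∃ s ∈ S, c < ‖π s v - v‖ := fun v c hc ↦ by
    obtain ⟨⟨s, hs⟩, h⟩ := exists_lt_of_lt_ciSup hc
    exact ⟨s, hs, h⟩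
  have hδ0 : ∀ v, 0 ≤ δ v := fun v ↦ (norm_nonneg _).trans (hle v _ hS.some_mem)
  by_contra! hcon
  have hstep : ∀ v, ∃ x, ‖x - v‖ ≤ R * δ v ∧ δ x ≤ δ v / 2 := by
    intro v
    rcases (hδ0 v).eq_or_lt with h0 | h0
    · exact ⟨v, by simp [← h0], by simp [← h0]⟩
    · obtain ⟨x, hx, h⟩ := hcon v (δ v) h0 (hle v)
      refine ⟨x, hx, ?_⟩
      by_contra! hgt
      obtain ⟨s, hs, hs'⟩ := hlt x (δ v / 4) (by linarith)
      exact (h s hs).not_ge hs'.le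
  choose f hf1 hf2 using hstep
  obtain ⟨v₀, hv₀, hdisp⟩ := hai (1 / (4 * R)) (by positivity)
  let u : ℕ → H := fun k ↦ f^[k] v₀
  have hu : ∀ k, u (k + 1) = f (u k) := fun k ↦ Function.iterate_succ_apply' f k v₀
  have hδu : ∀ k, δ (u k) ≤ δ v₀ / 2 ^ k := by
    intro k
    induction k with
    | zero => simp [u]
    | succ k ih =>
      rw [hu, pow_succ, ← div_div]
      exact (hf2 _).trans (div_le_div_of_nonneg_right ih two_pos.le)
  have hdist : ∀ k, dist (u k) (u (k + 1)) ≤ 2 * R * δ v₀ / 2 / 2 ^ k := fun k ↦ by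
    rw [dist_comm, dist_eq_norm, hu]
    refine (hf1 _).trans ((mul_le_mul_of_nonneg_left (hδu k) hR.le).trans_eq ?_)
    ring
  obtain ⟨v, hv⟩ := cauchySeq_tendsto_of_complete (cauchySeq_of_le_geometric_two hdist)
  have hvv : dist v₀ v ≤ 2 * R * δ v₀ := dist_le_of_le_geometric_two_of_tendsto₀ hdist hv
  have hδv₀ : δ v₀ ≤ 1 / (4 * R) := ciSup_le fun s ↦ (hdisp s s.2).le
  have hv0 : v = 0 := by
    refine hinv v fun s hs ↦ ?_
    rw [← sub_eq_zero, ← norm_le_zero_iff]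
    have h1 : Filter.Tendsto (fun k ↦ ‖π s (u k) - u k‖) Filter.atTop (nhds ‖π s v - v‖) :=
      ((((π s).continuous.tendsto v).comp hv).sub hv).norm
    have h2 : Filter.Tendsto (fun k : ℕ ↦ δ v₀ / 2 ^ k) Filter.atTop (nhds 0) := by
      simpa [div_eq_mul_inv] using
        (tendsto_pow_atTop_nhds_zero_of_lt_one (r := (2 : ℝ)⁻¹) (by norm_num)
          (by norm_num)).const_mul (δ v₀)
    exact le_of_tendsto_of_tendsto' h1 h2 fun k ↦ (hle _ s hs).trans (hδu k)
  rw [hv0, dist_zero_right, hv₀] at hvv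
  rw [le_div_iff₀ (by positivity)] at hδv₀
  linarith

section Averages
variable {Γ K : Type*} [Group Γ] [NormedAddCommGroup K] [InnerProductSpace ℂ K]

/-- Operators generated by the unitaries of a subgroup under convex combination and composition. -/
inductive IsAverage (π : Γ →* (K ≃ₗᵢ[ℂ] K)) (Z : Subgroup Γ) : (K →ₗ[ℂ] K) → Prop
  | of (z : Γ) (hz : z ∈ Z) : IsAverage π Z (π z).toLinearEquiv
  | convex (M N : K →ₗ[ℂ] K) (s t : ℝ) (hM : IsAverage π Z M) (hN : IsAverage π Z N)
      (hs : 0 ≤ s) (ht : 0 ≤ t) (hst : s + t = 1) : IsAverage π Z ((s : ℂ) • M + (t : ℂ) • N)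
  | comp (M N : K →ₗ[ℂ] K) (hM : IsAverage π Z M) (hN : IsAverage π Z N) :
      IsAverage π Z (M ∘ₗ N)

namespace IsAverage
variable {π : Γ →* (K ≃ₗᵢ[ℂ] K)} {Z : Subgroup Γ} {M : K →ₗ[ℂ] K}

theorem norm_le (hM : IsAverage π Z M) (v : K) : ‖M v‖ ≤ ‖v‖ := by
  induction hM generalizing v with
  | of z hz => exact ((π z).norm_map v).le
  | convex M N s t _ _ hs ht hst ihM ihN =>
    refine (norm_add_le _ _).trans ?_
    simp only [LinearMap.smul_apply, norm_smul, Complex.norm_real, Real.norm_of_nonneg hs,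
      Real.norm_of_nonneg ht]
    calc _ ≤ s * ‖v‖ + t * ‖v‖ := by gcongr <;> solve_by_elim
      _ = ‖v‖ := by rw [← add_mul, hst, one_mul]
  | comp M N _ _ ihM ihN => exact (ihM _).trans (ihN v)

theorem commute (hM : IsAverage π Z M) (hZ : ∀ z ∈ Z, ∀ g, z * g = g * z) (g : Γ) (v : K) :
    M (π g v) = π g (M v) := by
  induction hM generalizing v with
  | of z hz =>
    show (π z * π g) v = (π g * π z) v
    rw [← map_mul, ← map_mul, hZ z hz]
  | convex M N s t _ _ _ _ _ ihM ihN =>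
    simp only [LinearMap.add_apply, LinearMap.smul_apply, ihM, ihN, map_add, map_smul]
  | comp M N _ _ ihM ihN => simp [ihM, ihN]

theorem apply_of_fixed (hM : IsAverage π Z M) {v : K} (hv : ∀ z ∈ Z, π z v = v) : M v = v := by
  induction hM with
  | of z hz => exact hv z hz
  | convex M N s t _ _ _ _ hst ihM ihN =>
    simp only [LinearMap.add_apply, LinearMap.smul_apply, ihM, ihN]
    rw [← add_smul, ← Complex.ofReal_add, hst, Complex.ofReal_one, one_smul]
  | comp M N _ _ ihM ihN => simp [ihM, ihN]

theorem inner_right (hM : IsAverage π Z M) {v : K} (hv : ∀ z ∈ Z, π z v = v) (k : K) :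
    inner ℂ v (M k) = inner ℂ v k := by
  induction hM generalizing k with
  | of z hz =>
    show inner ℂ v (π z k) = _
    nth_rw 1 [← hv z hz]
    exact (π z).inner_map_map v k
  | convex M N s t _ _ _ _ hst ihM ihN =>
    simp only [LinearMap.add_apply, LinearMap.smul_apply, inner_add_right, inner_smul_right,
      ihM, ihN]
    rw [← add_mul, ← Complex.ofReal_add, hst, Complex.ofReal_one, one_mul]
  | comp M N _ _ ihM ihN => rw [LinearMap.comp_apply, ihM, ihN]

/-- An average of a cocycle differs from it by a coboundary. -/
theorem exists_coboundary (hM : IsAverage π Z M) (hZ : ∀ z ∈ Z, ∀ g, z * g = g * z) {b : Γ → K}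
    (hb : ∀ g h, b (g * h) = b g + π g (b h)) : ∃ y, ∀ g, π g y + b g - y = M (b g) := by
  induction hM generalizing b with
  | of z hz =>
    refine ⟨b z, fun g ↦ ?_⟩
    have := hb z g
    rw [hZ z hz g, hb] at this
    rw [add_comm, this]
    exact add_sub_cancel_left _ _
  | convex M N s t _ _ _ _ hst ihM ihN =>
    obtain ⟨y₁, h₁⟩ := ihM hb
    obtain ⟨y₂, h₂⟩ := ihN hb
    refine ⟨(s : ℂ) • y₁ + (t : ℂ) • y₂, fun g ↦ ?_⟩
    have h : b g = (s : ℂ) • b g + (t : ℂ) • b g := by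
      rw [← add_smul, ← Complex.ofReal_add, hst, Complex.ofReal_one, one_smul]
    simp only [LinearMap.add_apply, LinearMap.smul_apply, ← h₁, ← h₂, map_add, map_smul]
    nth_rw 1 [h]
    module
  | comp M N _ _ ihM ihN =>
    obtain ⟨y₁, h₁⟩ := ihN hb
    obtain ⟨y₂, h₂⟩ := ihM (b := fun g ↦ N (b g)) fun g h ↦ by
      have hm : π (g * h) y₁ = π g (π h y₁) := by rw [map_mul]; rfl
      show N (b (g * h)) = N (b g) + π g (N (b h))
      rw [← h₁, ← h₁, ← h₁, hm, hb, map_sub, map_add]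
      abel
    refine ⟨y₁ + y₂, fun g ↦ ?_⟩
    rw [LinearMap.comp_apply, ← h₂, ← h₁, map_add]
    abel

end IsAverage

variable [CompleteSpace K]

/-- The closure of a nonempty convex subset of a Hilbert space contains a vector fixed by all the
linear isometries that preserve it. -/
theorem exists_fixed_mem_closure {W : Set K} (hWn : W.Nonempty) (hWc : Convex ℝ W) :
    ∃ m ∈ closure W, ∀ f : K →ₗᵢ[ℂ] K, (∀ x ∈ closure W, f x ∈ closure W) → f m = m := by
  have hC : Convex ℝ (closure W) := hWc.closure
  obtain ⟨m, hm, hmin⟩ : ∃ m ∈ closure W, ‖(0 : K) - m‖ = ⨅ w : closure W, ‖(0 : K) - w‖ := by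
    let _ : InnerProductSpace ℝ K := InnerProductSpace.complexToReal
    exact exists_norm_eq_iInf_of_complete_convex hWn.closure isClosed_closure.isComplete hC 0
  have hle : ∀ w ∈ closure W, ‖m‖ ≤ ‖w‖ := by
    intro w hw
    have : (⨅ w : closure W, ‖(0 : K) - w‖) ≤ ‖(0 : K) - w‖ :=
      ciInf_le (f := fun w : closure W ↦ ‖(0 : K) - w‖)
        ⟨0, by rintro _ ⟨w, rfl⟩; exact norm_nonneg _⟩ ⟨w, hw⟩
    rw [← hmin] at this
    simpa using this
  refine ⟨m, hm, fun f hf ↦ ?_⟩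
  have hmid := hle _ (hC hm (hf m hm) (a := 1 / 2) (b := 1 / 2) (by norm_num)
    (by norm_num) (by norm_num))
  rw [← smul_add, norm_smul, Real.norm_of_nonneg (by norm_num)] at hmid
  have hp := parallelogram_law_with_norm ℂ m (f m)
  rw [f.norm_map] at hp
  have h2 : 2 * ‖m‖ ≤ ‖m + f m‖ := by linarith
  have h3 : (2 * ‖m‖) * (2 * ‖m‖) ≤ ‖m + f m‖ * ‖m + f m‖ :=
    mul_self_le_mul_self (by positivity) h2
  have h4 : ‖m - f m‖ * ‖m - f m‖ ≤ 0 := by linarith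
  have h5 : ‖m - f m‖ = 0 := mul_self_eq_zero.1 (le_antisymm h4 (mul_self_nonneg _))
  exact (sub_eq_zero.1 (norm_eq_zero.1 h5)).symm

theorem exists_average_norm_lt (π : Γ →* (K ≃ₗᵢ[ℂ] K)) (Z : Subgroup Γ) {k : K}
    (hk : ∀ v, (∀ z ∈ Z, π z v = v) → inner ℂ v k = 0) {ε : ℝ} (hε : 0 < ε) :
    ∃ M, IsAverage π Z M ∧ ‖M k‖ < ε := by
  let W : Set K := {x | ∃ M, IsAverage π Z M ∧ M k = x}
  have hWn : W.Nonempty := ⟨k, _, .of 1 Z.one_mem, by simp⟩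
  have hWc : Convex ℝ W := by
    rintro _ ⟨M, hM, rfl⟩ _ ⟨N, hN, rfl⟩ s t hs ht hst
    exact ⟨_, .convex M N s t hM hN hs ht hst, by simp⟩
  have hWz : ∀ z ∈ Z, ∀ x ∈ closure W, π z x ∈ closure W := by
    intro z hz x hx
    refine map_mem_closure (π z).continuous hx ?_
    rintro _ ⟨M, hM, rfl⟩
    exact ⟨_, .comp _ M (.of z hz) hM, rfl⟩
  have hWo : ∀ v, (∀ z ∈ Z, π z v = v) → ∀ x ∈ closure W, inner ℂ v x = 0 := by
    intro v hv x hx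
    refine closure_minimal (t := {x | inner ℂ v x = 0}) ?_
      (isClosed_eq (continuous_const.inner continuous_id) continuous_const) hx
    rintro _ ⟨M, hM, rfl⟩
    show inner ℂ v (M k) = 0
    rw [hM.inner_right hv, hk v hv]
  obtain ⟨m, hm, hmin⟩ := exists_fixed_mem_closure hWn hWc
  have hfix : ∀ z ∈ Z, π z m = m := fun z hz ↦ hmin (π z).toLinearIsometry (hWz z hz)
  have hm0 : m = 0 := inner_self_eq_zero.1 (hWo m hfix m hm)
  rw [hm0] at hm
  obtain ⟨_, ⟨M, hM, rfl⟩, h⟩ := Metric.mem_closure_iff.1 hm ε hε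
  exact ⟨M, hM, by simpa using h⟩

/-- The projection onto the vectors fixed by a central subgroup is a limit of averages, so up to
small error it changes a cocycle by a coboundary wherever the cocycle is relatively compact. -/
theorem exists_central_projection (π : Γ →* (K ≃ₗᵢ[ℂ] K)) {Z : Subgroup Γ}
    (hZ : ∀ z ∈ Z, ∀ g, z * g = g * z) :
    ∃ P : K →ₗ[ℂ] K, (∀ v, ‖P v‖ ≤ ‖v‖) ∧ (∀ g v, P (π g v) = π g (P v)) ∧
      (∀ z ∈ Z, ∀ v, π z (P v) = P v) ∧
      ∀ (b : Γ → K), (∀ g h, b (g * h) = b g + π g (b h)) → ∀ (A : Set Γ) (C : Set K),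
        IsCompact C → (∀ a ∈ A, b a ∈ C) → ∀ ε : ℝ, 0 < ε →
          ∃ y, ∀ a ∈ A, ‖π a y + b a - y - P (b a)‖ ≤ ε := by
  let I : Submodule ℂ K := invariantVectors (π.comp Z.subtype)
  have hI : ∀ v, v ∈ I ↔ ∀ z ∈ Z, π z v = v := fun v ↦ by
    simp [I, mem_invariantVectors]
  have : CompleteSpace I := (isClosed_invariantVectors _).completeSpace_coe
  let P : K →L[ℂ] K := I.starProjection
  have hPI : ∀ v, P v ∈ I := fun v ↦ I.starProjection_apply_mem v
  have hPn : ∀ v, ‖P v‖ ≤ ‖v‖ := fun v ↦ I.norm_starProjection_apply_le v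
  have hMP : ∀ M, IsAverage π Z M → ∀ v, M (P v) = P v := fun M hM v ↦
    hM.apply_of_fixed ((hI _).1 (hPI v))
  have happrox : ∀ (v : K) (ε : ℝ), 0 < ε → ∃ M, IsAverage π Z M ∧ ‖M v - P v‖ < ε := by
    intro v ε hε
    obtain ⟨M, hM, h⟩ := exists_average_norm_lt π Z (k := v - P v) (fun w hw ↦
      I.sub_starProjection_mem_orthogonal v w ((hI w).2 hw)) hε
    exact ⟨M, hM, by rwa [map_sub, hMP M hM] at h⟩
  have hPM : ∀ M, IsAverage π Z M → ∀ v, P (M v) = P v := by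
    intro M hM
    induction hM with
    | of z hz =>
      intro v
      show P (π z v) = P v
      refine (I.eq_starProjection_of_mem_of_inner_eq_zero (hPI v) fun w hw ↦ ?_)
      have hz1 : π z (P v) = P v := (hI _).1 (hPI v) z hz
      have hz2 : π z w = w := (hI _).1 hw z hz
      rw [← hz1, ← hz2, ← map_sub, LinearIsometryEquiv.inner_map_map]
      exact I.starProjection_inner_eq_zero v w hw
    | convex M N s t _ _ _ _ hst ihM ihN =>
      intro v
      simp only [LinearMap.add_apply, LinearMap.smul_apply, map_add, map_smul, ihM, ihN]
      rw [← add_smul, ← Complex.ofReal_add, hst, Complex.ofReal_one, one_smul]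
    | comp M N _ _ ihM ihN => intro v; rw [LinearMap.comp_apply, ihM, ihN]
  have hfin : ∀ (ε : ℝ), 0 < ε → ∀ F : Set K, F.Finite → ∃ M, IsAverage π Z M ∧
      ∀ v ∈ F, ‖M v - P v‖ < ε := by
    intro ε hε F hF
    induction F, hF using Set.Finite.induction_on with
    | empty => exact ⟨_, .of 1 Z.one_mem, by simp⟩
    | @insert x F _ _ ih =>
      obtain ⟨M, hM, h⟩ := ih
      obtain ⟨N, hN, h'⟩ := happrox (M x) ε hε
      refine ⟨_, .comp N M hN hM, ?_⟩
      rintro v (rfl | hv)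
      · rwa [hPM M hM] at h'
      · rw [LinearMap.comp_apply, ← hMP N hN v, ← map_sub]
        exact (hN.norm_le _).trans_lt (h v hv)
  have hcpt : ∀ (ε : ℝ), 0 < ε → ∀ C : Set K, IsCompact C → ∃ M, IsAverage π Z M ∧
      ∀ v ∈ C, ‖M v - P v‖ ≤ ε := by
    intro ε hε C hC
    obtain ⟨F, -, hF, hCF⟩ := hC.finite_cover_balls (show 0 < ε / 3 by positivity)
    obtain ⟨M, hM, h⟩ := hfin (ε / 3) (by positivity) F hF
    refine ⟨M, hM, fun v hv ↦ ?_⟩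
    obtain ⟨x, hx, hvx⟩ := Set.mem_iUnion₂.1 (hCF hv)
    rw [Metric.mem_ball, dist_eq_norm] at hvx
    have : M v - P v = M (v - x) + (M x - P x) - P (v - x) := by
      simp only [map_sub]; abel
    rw [this]
    refine (norm_sub_le _ _).trans ?_
    have h1 := norm_add_le (M (v - x)) (M x - P x)
    have h2 := hM.norm_le (v - x)
    have h3 := hPn (v - x)
    have h4 := h x hx
    linarith
  refine ⟨P, hPn, fun g v ↦ ?_, fun z hz v ↦ (hI _).1 (hPI v) z hz, fun b hb A C hC hA ε hε ↦ ?_⟩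
  · refine eq_of_forall_dist_le fun ε hε ↦ ?_
    obtain ⟨M, hM, h⟩ := hfin (ε / 2) (by positivity) {π g v, v} (by simp)
    have h1 := h (π g v) (by simp)
    have h2 := h v (by simp)
    rw [hM.commute hZ] at h1
    rw [← (π g).norm_map, map_sub] at h2
    rw [dist_eq_norm]
    have : P (π g v) - π g (P v) = (π g (M v) - π g (P v)) - (π g (M v) - P (π g v)) := by abel
    show ‖P (π g v) - π g (P v)‖ ≤ ε
    rw [this]
    exact (norm_sub_le _ _).trans (by linarith)
  · obtain ⟨M, hM, h⟩ := hcpt ε hε C hC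
    obtain ⟨y, hy⟩ := hM.exists_coboundary hZ hb
    refine ⟨y, fun a ha ↦ ?_⟩
    rw [hy]
    exact h _ (hA a ha)

end Averages

open Pointwise in
/-- A cocycle vanishes at a central element fixing its values if the powers of that element are
coarsely contained in the commutator subgroup. -/
theorem cocycle_eq_zero_of_central {G K : Type*} [Group G] [NormedAddCommGroup K]
    [InnerProductSpace ℂ K] (σ : G →* (K ≃ₗᵢ[ℂ] K)) (c : G → K)
    (hc : ∀ g h, c (g * h) = c g + σ g (c h)) {z : G} (hz : ∀ g, z * g = g * z)
    (hfix : ∀ g, σ z (c g) = c g) {C : Set G} {B : ℝ} (hB : ∀ x ∈ C, ‖c x‖ ≤ B)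
    (hC : ∀ n : ℕ, z ^ n ∈ C * (commutator G : Set G)) : c z = 0 := by
  have hσ : ∀ g, σ g (c z) = c z := fun g ↦ by
    have h := hc z g
    rw [hz, hc, hfix, add_comm] at h
    exact add_right_cancel h
  let χ : G →* Multiplicative ℂ := MonoidHom.mk' (fun g ↦ .ofAdd (inner ℂ (c z) (c g)))
    fun g h ↦ by
      have hi := (σ g).inner_map_map (c z) (c h)
      rw [hσ] at hi
      rw [← ofAdd_add, hc, inner_add_right, hi]
  have hn : ∀ n : ℕ, n * (‖c z‖ * ‖c z‖) ≤ ‖c z‖ * B := fun n ↦ by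
    obtain ⟨x, hx, w, hw, hxw⟩ := hC n
    have hw1 : χ w = 1 := Abelianization.commutator_subset_ker χ hw
    have h := congrArg (fun g ↦ (χ g).toAdd) hxw
    simp only [map_mul, hw1, mul_one, map_pow, toAdd_pow] at h
    have h' : inner ℂ (c z) (c x) = n • inner ℂ (c z) (c z) := h
    have h2 := norm_inner_le_norm (𝕜 := ℂ) (c z) (c x)
    rw [h', inner_self_eq_norm_sq_to_K, nsmul_eq_mul, norm_mul, norm_pow] at h2
    simp only [Complex.norm_natCast, RCLike.norm_ofReal, abs_norm] at h2
    nlinarith [hB x hx, norm_nonneg (c z)]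
  by_contra h0
  have hpos : 0 < ‖c z‖ := norm_pos_iff.2 h0
  obtain ⟨n, hn'⟩ := exists_nat_gt (B / ‖c z‖)
  rw [div_lt_iff₀ hpos] at hn'
  nlinarith [hn n]

section Ultraproduct
open Filter Topology

/-- The sequences of vectors bounded along an ultrafilter. -/
def boundedSeq (U : Ultrafilter ℕ) (H : Type*) [NormedAddCommGroup H] [InnerProductSpace ℂ H] :
    Submodule ℂ (ℕ → H) where
  carrier := {x | ∃ B : ℝ, ∀ᶠ n in U, ‖x n‖ ≤ B}
  add_mem' := by
    rintro x y ⟨B, hB⟩ ⟨B', hB'⟩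
    refine ⟨B + B', ?_⟩
    filter_upwards [hB, hB'] with n h h' using (norm_add_le _ _).trans (add_le_add h h')
  zero_mem' := ⟨0, by simp⟩
  smul_mem' := by
    rintro c x ⟨B, hB⟩
    refine ⟨‖c‖ * B, ?_⟩
    filter_upwards [hB] with n h
    rw [Pi.smul_apply, norm_smul]
    gcongr

variable {H : Type*} [NormedAddCommGroup H] [InnerProductSpace ℂ H]

theorem tendsto_inner_boundedSeq (U : Ultrafilter ℕ) (x y : boundedSeq U H) :
    Tendsto (fun n ↦ inner ℂ (x.1 n) (y.1 n)) U
      (𝓝 (limUnder U fun n ↦ inner ℂ (x.1 n) (y.1 n))) := by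
  obtain ⟨B, hB⟩ := x.2
  obtain ⟨B', hB'⟩ := y.2
  obtain ⟨l, -, hl⟩ := (isCompact_closedBall (0 : ℂ) (B * B')).ultrafilter_le_nhds
    (U.map fun n ↦ inner ℂ (x.1 n) (y.1 n)) (by
      rw [le_principal_iff, Ultrafilter.mem_coe, Ultrafilter.mem_map]
      filter_upwards [hB, hB'] with n h h'
      rw [Set.mem_preimage, mem_closedBall_zero_iff]
      exact (norm_inner_le_norm _ _).trans
        (mul_le_mul h h' (norm_nonneg _) ((norm_nonneg _).trans h)))
  exact tendsto_nhds_limUnder ⟨l, hl⟩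

/-- The ultrapower of a unitary representation, acted upon by sequences of group elements. -/
theorem exists_ultrapower.{u, w} {G : Type w} [Group G] {H : Type u} [NormedAddCommGroup H]
    [InnerProductSpace ℂ H] (U : Ultrafilter ℕ) (π : G →* (H ≃ₗᵢ[ℂ] H)) :
    ∃ (K : Type u) (_ : NormedAddCommGroup K) (_ : InnerProductSpace ℂ K) (_ : CompleteSpace K)
      (j : boundedSeq U H →ₗ[ℂ] K) (ρ : (ℕ → G) →* (K ≃ₗᵢ[ℂ] K)), DenseRange j ∧
      (∀ x, Tendsto (fun n ↦ ‖x.1 n‖) U (𝓝 ‖j x‖)) ∧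
      ∀ γ (x y : boundedSeq U H), (∀ n, y.1 n = π (γ n) (x.1 n)) → ρ γ (j x) = j y := by
  let c : PreInnerProductSpace.Core ℂ (boundedSeq U H) :=
    { inner := fun x y ↦ limUnder U fun n ↦ inner ℂ (x.1 n) (y.1 n)
      conj_inner_symm := fun x y ↦ by
        refine tendsto_nhds_unique (((Complex.continuous_conj.tendsto _).comp
          (tendsto_inner_boundedSeq U y x)).congr fun n ↦ ?_) (tendsto_inner_boundedSeq U x y)
        exact inner_conj_symm _ _
      add_left := fun x y z ↦ by
        refine tendsto_nhds_unique (tendsto_inner_boundedSeq U (x + y) z)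
          (((tendsto_inner_boundedSeq U x z).add (tendsto_inner_boundedSeq U y z)).congr
            fun n ↦ ?_)
        exact (inner_add_left _ _ _).symm
      smul_left := fun x y r ↦ by
        refine tendsto_nhds_unique (tendsto_inner_boundedSeq U (r • x) y)
          (((tendsto_inner_boundedSeq U x y).const_mul (starRingEnd ℂ r)).congr fun n ↦ ?_)
        exact (inner_smul_left _ _ _).symm
      re_inner_nonneg := fun x ↦ by
        refine ge_of_tendsto' ((Complex.continuous_re.tendsto _).comp
          (tendsto_inner_boundedSeq U x x)) fun n ↦ ?_
        exact inner_self_nonneg (𝕜 := ℂ) }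
  have hmem : ∀ (γ : ℕ → G) (x : boundedSeq U H), (fun n ↦ π (γ n) (x.1 n)) ∈ boundedSeq U H := by
    rintro γ ⟨x, B, hB⟩
    exact ⟨B, by simpa using hB⟩
  let ρ : (ℕ → G) →* Module.End ℂ (boundedSeq U H) :=
    { toFun := fun γ ↦
        { toFun := fun x ↦ ⟨fun n ↦ π (γ n) (x.1 n), hmem γ x⟩
          map_add' := fun x y ↦ Subtype.ext <| funext fun n ↦ map_add (π (γ n)) _ _
          map_smul' := fun r x ↦ Subtype.ext <| funext fun n ↦ map_smul (π (γ n)) _ _ }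
      map_one' := by ext x n; simp
      map_mul' := fun γ δ ↦ by ext x n; simp }
  obtain ⟨K, i₁, i₂, i₃, j, σ, hd, hj, hσ⟩ := exists_unitaryRep_completion c ρ fun γ x y ↦ by
    show limUnder U (fun n ↦ inner ℂ (π (γ n) (x.1 n)) (π (γ n) (y.1 n))) =
      limUnder U (fun n ↦ inner ℂ (x.1 n) (y.1 n))
    simp only [LinearIsometryEquiv.inner_map_map]
  refine ⟨K, i₁, i₂, i₃, j, σ, hd, fun x ↦ ?_, fun γ x y hxy ↦ ?_⟩
  · have h : Tendsto (fun n ↦ √(RCLike.re (inner ℂ (x.1 n) (x.1 n)))) U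
        (𝓝 √(RCLike.re (inner ℂ (j x) (j x)))) := by
      rw [hj]
      exact (Real.continuous_sqrt.tendsto _).comp
        ((Complex.continuous_re.tendsto _).comp (tendsto_inner_boundedSeq U x x))
    simpa only [← norm_eq_sqrt_re_inner] using h
  · rw [hσ]
    congr 1
    exact Subtype.ext (funext fun n ↦ (hxy n).symm)

end Ultraproduct

open Pointwise in
theorem norm_map_sub_le_of_mem_pow {G H : Type*} [Group G] [NormedAddCommGroup H]
    [InnerProductSpace ℂ H] (π : G →* (H ≃ₗᵢ[ℂ] H)) {S : Set G} {v : H} {d : ℝ}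
    (hd : ∀ s ∈ S, ‖π s v - v‖ ≤ d) (k : ℕ) : ∀ g ∈ S ^ k, ‖π g v - v‖ ≤ k * d := by
  induction k with
  | zero => simp
  | succ k ih =>
    rw [pow_succ]
    rintro _ ⟨g, hg, s, hs, rfl⟩
    have h : π (g * s) v - v = π g (π s v - v) + (π g v - v) := by
      rw [map_mul, map_sub]; simp
    show ‖π (g * s) v - v‖ ≤ _
    rw [h]
    refine (norm_add_le _ _).trans ?_
    rw [LinearIsometryEquiv.norm_map]
    push_cast
    linarith [ih g hg, hd s hs]

section Limit
open Filter Topology Pointwise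

/-- The sequences in a bornological group staying in a bounded set along an ultrafilter. -/
def boundedSeqSubgroup {G : Type*} [Group G] [Bornology G]
    (hmul : ∀ A B : Set G, Bornology.IsBounded A → Bornology.IsBounded B →
      Bornology.IsBounded (A * B))
    (hinv : ∀ A : Set G, Bornology.IsBounded A → Bornology.IsBounded A⁻¹)
    (U : Ultrafilter ℕ) : Subgroup (ℕ → G) where
  carrier := {γ | ∃ A, Bornology.IsBounded A ∧ ∀ᶠ n in U, γ n ∈ A}
  mul_mem' := by
    rintro γ δ ⟨A, hA, hγ⟩ ⟨B, hB, hδ⟩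
    refine ⟨A * B, hmul A B hA hB, ?_⟩
    filter_upwards [hγ, hδ] with n h h' using Set.mul_mem_mul h h'
  one_mem' := ⟨{1}, Bornology.isBounded_singleton, by simp⟩
  inv_mem' := by
    rintro γ ⟨A, hA, hγ⟩
    exact ⟨A⁻¹, hinv A hA, by simpa using hγ⟩

/-- Rescaling almost invariant vectors of a representation without invariant vectors gives, in the
limit, an affine action displacing all points by a definite amount. -/
theorem exists_limit_cocycle.{u, w} {G : Type w} [Group G] [Bornology G]
    (hmul : ∀ A B : Set G, Bornology.IsBounded A → Bornology.IsBounded B →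
      Bornology.IsBounded (A * B))
    (hinv : ∀ A : Set G, Bornology.IsBounded A → Bornology.IsBounded A⁻¹)
    {S : Set G} (hSn : S.Nonempty) (hSb : Bornology.IsBounded S)
    (hS : ∀ C : Set G, Bornology.IsBounded C → ∃ n : ℕ, C ⊆ S ^ n)
    {H : Type u} [NormedAddCommGroup H] [InnerProductSpace ℂ H] [CompleteSpace H]
    (π : G →* (H ≃ₗᵢ[ℂ] H)) (hfix : ∀ v, (∀ s ∈ S, π s v = v) → v = 0)
    (hai : ∀ ε : ℝ, 0 < ε → ∃ v, ‖v‖ = 1 ∧ ∀ s ∈ S, ‖π s v - v‖ < ε) (U : Ultrafilter ℕ)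
    (hU : (U : Filter ℕ) ≤ atTop) :
    ∃ (K : Type u) (_ : NormedAddCommGroup K) (_ : InnerProductSpace ℂ K) (_ : CompleteSpace K)
      (σ : boundedSeqSubgroup hmul hinv U →* (K ≃ₗᵢ[ℂ] K)) (b : boundedSeqSubgroup hmul hinv U → K),
      (∀ g h, b (g * h) = b g + σ g (b h)) ∧
      (∀ (k : ℕ) (g : boundedSeqSubgroup hmul hinv U), (∀ᶠ n in U, g.1 n ∈ S ^ k) → ‖b g‖ ≤ k) ∧
      ∀ x, ∃ s : boundedSeqSubgroup hmul hinv U, (∀ᶠ n in U, s.1 n ∈ S) ∧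
        1 / 8 ≤ ‖σ s x + b s - x‖ := by
  choose v d hd hvd hfar using fun n : ℕ ↦ exists_displacement_almost_minimal π hSn hfix hai
    (R := n + 1) (by positivity)
  obtain ⟨K, i₁, i₂, i₃, j, ρ, hj, hjn, hρ⟩ := exists_ultrapower U π
  have hbd : ∀ (k : ℕ) (g : ℕ → G), (∀ᶠ n in U, g n ∈ S ^ k) →
      ∀ᶠ n in U, ‖((d n)⁻¹ : ℂ) • (π (g n) (v n) - v n)‖ ≤ k := by
    intro k g hg
    filter_upwards [hg] with n h
    rw [norm_smul, norm_inv, Complex.norm_real, Real.norm_of_nonneg (hd n).le,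
      inv_mul_le_iff₀ (hd n), mul_comm]
    exact norm_map_sub_le_of_mem_pow π (hvd n) k _ h
  let c : boundedSeqSubgroup hmul hinv U → boundedSeq U H := fun g ↦
    ⟨fun n ↦ ((d n)⁻¹ : ℂ) • (π (g.1 n) (v n) - v n), by
      obtain ⟨A, hA, hg⟩ := g.2
      obtain ⟨k, hk⟩ := hS A hA
      exact ⟨k, hbd k g.1 (hg.mono fun n h ↦ hk h)⟩⟩
  have hact : ∀ (g : ℕ → G) (x : boundedSeq U H), ∃ y : boundedSeq U H,
      (∀ n, y.1 n = π (g n) (x.1 n)) ∧ ρ g (j x) = j y := by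
    intro g x
    have hy : (fun n ↦ π (g n) (x.1 n)) ∈ boundedSeq U H := by
      obtain ⟨B, hB⟩ := x.2
      exact ⟨B, by simpa using hB⟩
    exact ⟨⟨_, hy⟩, fun n ↦ rfl, hρ g x ⟨_, hy⟩ fun n ↦ rfl⟩
  refine ⟨K, i₁, i₂, i₃, ρ.comp (Subgroup.subtype _), fun g ↦ j (c g), fun g h ↦ ?_,
    fun k g hg ↦ le_of_tendsto (hjn _) (hbd k g.1 hg), fun x ↦ ?_⟩
  · obtain ⟨y, hy, hyρ⟩ := hact g.1 (c h)
    show j (c (g * h)) = j (c g) + ρ g.1 (j (c h))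
    rw [hyρ, ← map_add]
    congr 1
    refine Subtype.ext (funext fun n ↦ ?_)
    show ((d n)⁻¹ : ℂ) • (π (g.1 n * h.1 n) (v n) - v n) = ((d n)⁻¹ : ℂ) • (π (g.1 n) (v n) - v n)
      + y.1 n
    rw [hy]
    show _ = _ + π (g.1 n) (((d n)⁻¹ : ℂ) • (π (h.1 n) (v n) - v n))
    rw [map_mul, map_smul, ← smul_add, map_sub, LinearIsometryEquiv.coe_mul, Function.comp_apply]
    congr 1
    abel
  · obtain ⟨w, hw⟩ := hj.exists_dist_lt x (show (0 : ℝ) < 1 / 16 by norm_num)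
    rw [dist_eq_norm] at hw
    obtain ⟨B, hB⟩ := w.2
    have hex : ∀ n, ∃ s ∈ S, ‖w.1 n‖ ≤ n + 1 →
        1 / 4 ≤ ‖π s (w.1 n) + ((d n)⁻¹ : ℂ) • (π s (v n) - v n) - w.1 n‖ := by
      intro n
      by_cases hn : ‖w.1 n‖ ≤ n + 1
      · obtain ⟨s, hs, h⟩ := hfar n (v n + (d n : ℂ) • w.1 n) (by
          rw [add_sub_cancel_left, norm_smul, Complex.norm_real, Real.norm_of_nonneg (hd n).le,
            mul_comm]
          gcongr
          exact (hd n).le)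
        refine ⟨s, hs, fun _ ↦ ?_⟩
        have hd0 : (d n : ℂ) ≠ 0 := by exact_mod_cast (hd n).ne'
        have he : π s (v n + (d n : ℂ) • w.1 n) - (v n + (d n : ℂ) • w.1 n) =
            (d n : ℂ) • (π s (w.1 n) + ((d n)⁻¹ : ℂ) • (π s (v n) - v n) - w.1 n) := by
          rw [map_add, map_smul, smul_sub, smul_add, smul_inv_smul₀ hd0]
          abel
        rw [he, norm_smul, Complex.norm_real, Real.norm_of_nonneg (hd n).le] at h
        nlinarith [hd n]
      · exact ⟨_, hSn.some_mem, fun h ↦ absurd h hn⟩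
    choose s hsS hs using hex
    have hsΓ : s ∈ boundedSeqSubgroup hmul hinv U := ⟨S, hSb, .of_forall hsS⟩
    refine ⟨⟨s, hsΓ⟩, .of_forall hsS, ?_⟩
    obtain ⟨y, hy, hyρ⟩ := hact s w
    have hlow : 1 / 4 ≤ ‖j (y + c ⟨s, hsΓ⟩ - w)‖ := by
      refine ge_of_tendsto (hjn _) ?_
      filter_upwards [hB, hU (eventually_ge_atTop ⌈B⌉₊)] with n h h'
      have hn : ‖w.1 n‖ ≤ n + 1 := by
        have := (Nat.le_ceil B).trans (Nat.cast_le.2 h')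
        linarith
      refine (hs n hn).trans_eq ?_
      rw [← hy]
      rfl
    rw [map_sub, map_add, ← hyρ] at hlow
    show 1 / 8 ≤ ‖ρ s x + j (c ⟨s, hsΓ⟩) - x‖
    have he : ρ s (j w) + j (c ⟨s, hsΓ⟩) - j w =
        (ρ s x + j (c ⟨s, hsΓ⟩) - x) - ρ s (x - j w) + (x - j w) := by
      rw [map_sub]; abel
    rw [he] at hlow
    have h1 := norm_add_le ((ρ s x + j (c ⟨s, hsΓ⟩) - x) - ρ s (x - j w)) (x - j w)
    have h2 := norm_sub_le (ρ s x + j (c ⟨s, hsΓ⟩) - x) (ρ s (x - j w))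
    rw [LinearIsometryEquiv.norm_map] at h2
    linarith

end Limit

/-- Coarse property (T) passes from a quotient to a central extension with kernel coarsely contained
in the commutator subgroup. -/
theorem CoarseT.of_central_quotient.{v, w, u} {G : Type w} {Q : Type u} [Group G] [Bornology G]
    [Group Q] [Bornology Q]
    (hmul : ∀ A B : Set G, Bornology.IsBounded A → Bornology.IsBounded B →
      Bornology.IsBounded (A * B))
    (hinv : ∀ A : Set G, Bornology.IsBounded A → Bornology.IsBounded A⁻¹)
    (hbg : ∃ C : Set G, Bornology.IsBounded C ∧ ∀ A : Set G, Bornology.IsBounded A →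
      ∃ t : Finset G, A ⊆ ⋃ g ∈ t, g • C)
    (hgen : ∃ S : Set G, Bornology.IsBounded S ∧
      ∀ C : Set G, Bornology.IsBounded C → ∃ n : ℕ, C ⊆ S ^ n)
    (p : G →* Q) (hsurj : Function.Surjective p)
    (hpb : ∀ B : Set Q, Bornology.IsBounded B → ∃ A : Set G, Bornology.IsBounded A ∧ B ⊆ p '' A)
    (hcentral : ∀ k ∈ p.ker, ∀ g : G, k * g = g * k)
    (hcomm : ∃ C : Set G, Bornology.IsBounded C ∧
      (p.ker : Set G) ⊆ C * (commutator G : Set G))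
    (hT : CoarseT.{u} Q) : CoarseT.{v} G := by
  classical
  intro H _ _ _ π hai
  by_contra! hno
  obtain ⟨S, hS1, hSb, hS⟩ := exists_generating_with_one hgen
  obtain ⟨C, hC1, hCb, hC⟩ := exists_covering_with_one hbg
  have hfix : ∀ v, (∀ s ∈ S, π s v = v) → v = 0 := by
    intro v hv
    by_contra hv0
    obtain ⟨g, hg⟩ := hno v hv0
    obtain ⟨n, hn⟩ := hS {g} Bornology.isBounded_singleton
    refine hg (sub_eq_zero.1 (norm_le_zero_iff.1 ?_))
    simpa using norm_map_sub_le_of_mem_pow π (d := 0) (fun s hs ↦ by simp [hv s hs]) n g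
      (hn rfl)
  let U : Ultrafilter ℕ := Filter.hyperfilter ℕ
  obtain ⟨K, _, _, _, σ, b, hb, hbk, hfar⟩ := exists_limit_cocycle hmul hinv ⟨1, hS1⟩ hSb hS π hfix
    (hai S hSb) U Nat.hyperfilter_le_atTop
  let Γ := boundedSeqSubgroup hmul hinv U
  let star : Set G → Set Γ := fun A ↦ {γ | ∀ᶠ n in U, γ.1 n ∈ A}
  let ι : G →* Γ :=
    { toFun := fun g ↦ ⟨fun _ ↦ g, {g}, Bornology.isBounded_singleton, by simp⟩
      map_one' := rfl
      map_mul' := fun _ _ ↦ rfl }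
  have hι : ∀ {A : Set G} {g : G}, g ∈ A → ι g ∈ star A := fun h ↦ .of_forall fun _ ↦ h
  have hcov : ∀ A : Set G, Bornology.IsBounded A →
      ∃ t : Finset G, ∀ γ ∈ star A, ∃ g ∈ t, (ι g)⁻¹ * γ ∈ star C := by
    intro A hA
    obtain ⟨t, ht⟩ := hC A hA
    refine ⟨t, fun γ hγ ↦ ?_⟩
    have h : (⋃ g ∈ (t : Set G), {n | γ.1 n ∈ g • C}) ∈ U := by
      filter_upwards [hγ] with n hn
      simpa using ht hn
    obtain ⟨g, hg, hgU⟩ := (Ultrafilter.finite_biUnion_mem_iff t.finite_toSet).1 h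
    refine ⟨g, hg, ?_⟩
    filter_upwards [hgU] with n hn using Set.mem_smul_set_iff_inv_smul_mem.1 hn
  obtain ⟨k, hk⟩ := hS C hCb
  obtain ⟨y, -, hy⟩ := exists_isCompact_orbit σ b hb (C := star C) ⟨1, hι hC1⟩ 0 k fun c hc ↦ by
    simpa using hbk k c (hc.mono fun n h ↦ hk h)
  obtain ⟨t, ht⟩ := hcov (S * C) (hmul _ _ hSb hCb)
  obtain ⟨K₀, hK₀, hyK⟩ := hy (star S) (t.image ι) (by
    rintro _ ⟨γ, hγ, δ, hδ, rfl⟩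
    obtain ⟨g, hg, h⟩ := ht (γ * δ) (by
      filter_upwards [hγ, hδ] with n h h' using Set.mul_mem_mul h h')
    exact Set.mem_iUnion₂.2 ⟨ι g, Finset.mem_image_of_mem ι hg,
      Set.mem_smul_set_iff_inv_smul_mem.2 h⟩)
  obtain ⟨P, hPn, hPσ, hPZ, hP⟩ := exists_central_projection σ (Z := p.ker.map ι) (by
    rintro _ ⟨z, hz, rfl⟩ γ
    exact Subtype.ext (funext fun n ↦ hcentral z hz (γ.1 n)))
  let b' : Γ → K := fun g ↦ σ g y + b g - y
  have hb' : ∀ g h, b' (g * h) = b' g + σ g (b' h) := fun g h ↦ by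
    have h2 : σ (g * h) y = σ g (σ h y) := by rw [map_mul]; rfl
    simp only [b', h2, hb, map_add, map_sub]
    abel
  let c : Γ → K := fun g ↦ P (b' g)
  have hc : ∀ g h, c (g * h) = c g + σ g (c h) := fun g h ↦ by
    simp only [c, hb', map_add, hPσ]
  have hcfar : ∀ x, ∃ s, 1 / 16 ≤ ‖σ s x + c s - x‖ := by
    intro x
    obtain ⟨z, hz⟩ := hP b' hb' (star S) ((fun v ↦ v - y) '' K₀)
      (hK₀.image (continuous_sub_right y)) (fun a ha ↦ ⟨_, hyK a ha, rfl⟩) (1 / 16) (by norm_num)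
    obtain ⟨s, hs, h⟩ := hfar (x + z + y)
    refine ⟨s, ?_⟩
    have he : σ s (x + z + y) + b s - (x + z + y) =
        (σ s x + c s - x) + (σ s z + b' s - z - P (b' s)) := by
      simp only [b', c, map_add]
      abel
    rw [he] at h
    linarith [norm_add_le (σ s x + c s - x) (σ s z + b' s - z - P (b' s)), hz s hs]
  have hck : ∀ (n : ℕ), ∀ γ ∈ star (S ^ n), ‖c γ‖ ≤ n + 2 * ‖y‖ := by
    intro n γ hγ
    have h1 := norm_sub_le (σ γ y + b γ) y
    have h2 := norm_add_le (σ γ y) (b γ)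
    rw [LinearIsometryEquiv.norm_map] at h2
    linarith [hPn (b' γ), hbk n γ hγ]
  have hcz : ∀ z ∈ p.ker, c (ι z) = 0 := by
    intro z hz
    obtain ⟨D, hD, hzD⟩ := hcomm
    obtain ⟨m, hm⟩ := hS D hD
    exact cocycle_eq_zero_of_central (σ.comp ι) (fun g ↦ c (ι g))
      (fun g h ↦ by rw [map_mul, hc]; rfl) (hcentral z hz)
      (fun g ↦ hPZ (ι z) ⟨z, hz, rfl⟩ _) (fun x hx ↦ hck m (ι x) (hι (hm hx)))
      fun n ↦ hzD (pow_mem hz n)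
  let β : Q → K := fun q ↦ c (ι (Function.surjInv hsurj q))
  have hβ : ∀ g, β (p g) = c (ι g) := by
    intro g
    set g' := Function.surjInv hsurj (p g) with hg'
    have hz : g * g'⁻¹ ∈ p.ker := by
      rw [MonoidHom.mem_ker, map_mul, map_inv, hg', Function.surjInv_eq hsurj, mul_inv_cancel]
    have h := hc (ι (g * g'⁻¹)) (ι g')
    rw [← map_mul, inv_mul_cancel_right, hcz _ hz, zero_add] at h
    rw [h]
    exact (hPZ _ ⟨_, hz, rfl⟩ _).symm
  have hβ1 : β 1 = 0 := by
    rw [← map_one p, hβ]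
    exact hcz 1 (one_mem _)
  obtain ⟨R, hR⟩ := hT.exists_norm_sub_le β (by
    intro r q q'
    obtain ⟨r, rfl⟩ := hsurj r
    obtain ⟨q, rfl⟩ := hsurj q
    obtain ⟨q', rfl⟩ := hsurj q'
    rw [← map_mul, ← map_mul, hβ, hβ, hβ, hβ, map_mul, map_mul, hc, hc, add_sub_add_left_eq_sub,
      ← map_sub, LinearIsometryEquiv.norm_map]) (by
    intro A hA
    obtain ⟨A', hA', hAA'⟩ := hpb A hA
    obtain ⟨n, hn⟩ := hS A' hA'
    refine ⟨n + 2 * ‖y‖, fun a ha ↦ ?_⟩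
    obtain ⟨g, hg, rfl⟩ := hAA' ha
    rw [hβ1, sub_zero, hβ]
    exact hck n _ (hι (hn hg)))
  have hcR : ∀ γ, ‖c γ‖ ≤ R + (k + 2 * ‖y‖) := by
    intro γ
    obtain ⟨A, hA, hγ⟩ := γ.2
    obtain ⟨t, ht⟩ := hcov A hA
    obtain ⟨g, -, hg⟩ := ht γ hγ
    have hδ : (ι g)⁻¹ * γ ∈ star (S ^ k) := hg.mono fun n h ↦ hk h
    have he := hc (ι g) ((ι g)⁻¹ * γ)
    rw [mul_inv_cancel_left] at he
    rw [he]
    refine (norm_add_le _ _).trans (add_le_add ?_ ?_)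
    · simpa [hβ1, hβ] using hR (p g)
    · rw [LinearIsometryEquiv.norm_map]
      exact hck k _ hδ
  obtain ⟨x, hx⟩ := exists_almost_fixed_of_bounded_cocycle σ c hc hcR
    (show (0 : ℝ) < 1 / 32 by norm_num)
  obtain ⟨s, hs⟩ := hcfar x
  linarith [hx s]

/-- Coarse property (T) passes to quotients with the pushforward bornology. -/
theorem CoarseT.of_surjective.{v, w, u} {G : Type w} {Q : Type u} [Group G] [Bornology G]
    [Group Q] [Bornology Q] (p : G →* Q) (hsurj : Function.Surjective p)
    (hp : ∀ A : Set G, Bornology.IsBounded A → Bornology.IsBounded (p '' A))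
    (hT : CoarseT.{v} G) : CoarseT.{v} Q := by
  intro H _ _ _ π hai
  obtain ⟨v, hv, hfix⟩ := hT H (π.comp p) fun A hA ε hε ↦ by
    obtain ⟨v, hv, h⟩ := hai (p '' A) (hp A hA) ε hε
    exact ⟨v, hv, fun a ha ↦ h (p a) ⟨a, ha, rfl⟩⟩
  refine ⟨v, hv, fun q ↦ ?_⟩
  obtain ⟨g, rfl⟩ := hsurj q
  exact hfix g

/-- **Serre's theorem on central extensions for bornological groups** (Theorem
`thm:Serre` of the paper).  Let `G` be a bornological group with bounded geometry whose
bornology is generated by a single set, and let `p : G → Q` be a surjective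
homomorphism; equip `Q` with the pushforward bornology.  If `ker p` is central in `G`
and coarsely contained in the commutator subgroup `[G,G]`, then `G` has coarse property
(T) if and only if `Q` has coarse property (T). -/
theorem coarseT_iff_of_central_extension
    {G Q : Type*} [Group G] [Bornology G] [Group Q] [Bornology Q]
    (hmul : ∀ A B : Set G, Bornology.IsBounded A → Bornology.IsBounded B →
      Bornology.IsBounded (A * B))
    (hinv : ∀ A : Set G, Bornology.IsBounded A → Bornology.IsBounded A⁻¹)
    (hbg : ∃ C : Set G, Bornology.IsBounded C ∧ ∀ A : Set G, Bornology.IsBounded A →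
      ∃ t : Finset G, A ⊆ ⋃ g ∈ t, g • C)
    (hgen : ∃ S : Set G, Bornology.IsBounded S ∧
      ∀ C : Set G, Bornology.IsBounded C → ∃ n : ℕ, C ⊆ S ^ n)
    (p : G →* Q) (hsurj : Function.Surjective p)
    (hQborn : ∀ B : Set Q, Bornology.IsBounded B ↔
      ∃ A : Set G, Bornology.IsBounded A ∧ B ⊆ p '' A)
    (hcentral : ∀ k ∈ p.ker, ∀ g : G, k * g = g * k)
    (hcomm : ∃ C : Set G, Bornology.IsBounded C ∧
      (p.ker : Set G) ⊆ C * (commutator G : Set G)) :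
    (∀ (H : Type*) [NormedAddCommGroup H] [InnerProductSpace ℂ H] [CompleteSpace H]
      (π : G →* (H ≃ₗᵢ[ℂ] H)),
      (∀ A : Set G, Bornology.IsBounded A → ∀ ε : ℝ, 0 < ε →
        ∃ v : H, ‖v‖ = 1 ∧ ∀ a ∈ A, ‖π a v - v‖ < ε) →
      ∃ v : H, v ≠ 0 ∧ ∀ g : G, π g v = v) ↔
    (∀ (H : Type*) [NormedAddCommGroup H] [InnerProductSpace ℂ H] [CompleteSpace H]
      (π : Q →* (H ≃ₗᵢ[ℂ] H)),
      (∀ A : Set Q, Bornology.IsBounded A → ∀ ε : ℝ, 0 < ε →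
        ∃ v : H, ‖v‖ = 1 ∧ ∀ a ∈ A, ‖π a v - v‖ < ε) →
      ∃ v : H, v ≠ 0 ∧ ∀ g : Q, π g v = v) := by
  have hp : ∀ A : Set G, Bornology.IsBounded A → Bornology.IsBounded (p '' A) := fun A hA ↦
    (hQborn _).2 ⟨A, hA, subset_rfl⟩
  have hpb : ∀ B : Set Q, Bornology.IsBounded B →
      ∃ A : Set G, Bornology.IsBounded A ∧ B ⊆ p '' A := fun B ↦ (hQborn B).1
  have hmulQ : ∀ A B : Set Q, Bornology.IsBounded A → Bornology.IsBounded B →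
      Bornology.IsBounded (A * B) := by
    intro A B hA hB
    obtain ⟨A', hA', hA⟩ := hpb A hA
    obtain ⟨B', hB', hB⟩ := hpb B hB
    refine (hp _ (hmul A' B' hA' hB')).subset ?_
    rw [Set.image_mul]
    exact Set.mul_subset_mul hA hB
  have hgenQ : ∃ S : Set Q, Bornology.IsBounded S ∧
      ∀ C : Set Q, Bornology.IsBounded C → ∃ n : ℕ, C ⊆ S ^ n := by
    obtain ⟨S, hS, h⟩ := hgen
    refine ⟨p '' S, hp S hS, fun B hB ↦ ?_⟩
    obtain ⟨A, hA, hBA⟩ := hpb B hB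
    obtain ⟨n, hn⟩ := h A hA
    refine ⟨n, hBA.trans ?_⟩
    rw [← Set.image_pow]
    exact Set.image_mono hn
  have hbgQ : ∃ C : Set Q, Bornology.IsBounded C ∧ ∀ A : Set Q, Bornology.IsBounded A →
      ∃ t : Finset Q, A ⊆ ⋃ g ∈ t, g • C := by
    classical
    obtain ⟨C, hC, h⟩ := hbg
    refine ⟨p '' C, hp C hC, fun B hB ↦ ?_⟩
    obtain ⟨A, hA, hBA⟩ := hpb B hB
    obtain ⟨t, ht⟩ := h A hA
    refine ⟨t.image p, hBA.trans ?_⟩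
    rintro _ ⟨a, ha, rfl⟩
    obtain ⟨g, hg, c, hc, rfl⟩ := Set.mem_iUnion₂.1 (ht ha)
    refine Set.mem_iUnion₂.2 ⟨p g, Finset.mem_image_of_mem p hg, p c, ⟨c, hc, rfl⟩, ?_⟩
    simp
  exact ⟨fun hT ↦ CoarseT.of_surjective p hsurj hp (CoarseT.change_universe hmul hbg hgen hT),
    fun hT ↦ CoarseT.of_central_quotient hmul hinv hbg hgen p hsurj hpb hcentral hcomm
      (CoarseT.change_universe hmulQ hbgQ hgenQ hT)⟩
end
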